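/- For every integer n ≥ 2 there exist a gentle algebra A of rank n and an almost-tilting A-module M such that M has exactly n + 1 isomorphism classes of complements, i.e. exactly n + 1 isomorphism classes of indecomposable A-modules N with N ∉ add M and M ⊕ N a tilting module. -/

import Mathlib

open CategoryTheory

universe u

/-- The combinatorial data of a gentle presentation: a finite quiver together with a
set of relations given by composable paths of length two, satisfying the gentle
conditions. -/
structure GentleQuiverData : Type (u + 1) where
  /-- vertices -/
  V : Type u
  /-- arrows -/
  E : Type u
  fintV : Fintype V
  fintE : Fintype E
  /-- source -/
  src : E → V
  /-- target -/
  tgt : E → V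
  /-- `rel a b` means that the length-two path `ab` is one of the generating relations -/
  rel : E → E → Prop
  rel_comp : ∀ a b, rel a b → tgt a = src b
  src_le_two : ∀ v : V, Set.ncard {a : E | src a = v} ≤ 2
  tgt_le_two : ∀ v : V, Set.ncard {a : E | tgt a = v} ≤ 2
  rel_right_unique : ∀ a b c, rel a b → rel a c → b = c
  rel_left_unique : ∀ a b c, rel b a → rel c a → b = c
  nonrel_right_unique : ∀ a b c, tgt a = src b → ¬ rel a b → tgt a = src c → ¬ rel a c → b = c
  nonrel_left_unique : ∀ a b c, tgt b = src a → ¬ rel b a → tgt c = src a → ¬ rel c a → b = c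

attribute [instance] GentleQuiverData.fintV GentleQuiverData.fintE

/-- The quiver is connected. -/
def GentleQuiverData.Connected (Q : GentleQuiverData.{u}) : Prop :=
  ∀ v w : Q.V, Relation.ReflTransGen
    (fun x y => ∃ a : Q.E, (Q.src a = x ∧ Q.tgt a = y) ∨ (Q.src a = y ∧ Q.tgt a = x)) v w

variable (k : Type u) [Field k]

/-- The relations presenting the gentle algebra `kQ/I` as a quotient of the free algebra
on vertices and arrows: the vertices are orthogonal idempotents summing to `1`, arrows are
compatible with sources and targets, and the chosen length-two paths vanish. -/
inductive GentleRel (Q : GentleQuiverData.{u}) :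
    FreeAlgebra k (Q.V ⊕ Q.E) → FreeAlgebra k (Q.V ⊕ Q.E) → Prop
  | idem (v : Q.V) :
      GentleRel Q (FreeAlgebra.ι k (Sum.inl v) * FreeAlgebra.ι k (Sum.inl v))
        (FreeAlgebra.ι k (Sum.inl v))
  | orth (v w : Q.V) : v ≠ w →
      GentleRel Q (FreeAlgebra.ι k (Sum.inl v) * FreeAlgebra.ι k (Sum.inl w)) 0
  | sum_idem :
      GentleRel Q (∑ v : Q.V, FreeAlgebra.ι k (Sum.inl v)) 1
  | src_mul (a : Q.E) :
      GentleRel Q (FreeAlgebra.ι k (Sum.inl (Q.src a)) * FreeAlgebra.ι k (Sum.inr a))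
        (FreeAlgebra.ι k (Sum.inr a))
  | mul_tgt (a : Q.E) :
      GentleRel Q (FreeAlgebra.ι k (Sum.inr a) * FreeAlgebra.ι k (Sum.inl (Q.tgt a)))
        (FreeAlgebra.ι k (Sum.inr a))
  | relation (a b : Q.E) : Q.rel a b →
      GentleRel Q (FreeAlgebra.ι k (Sum.inr a) * FreeAlgebra.ι k (Sum.inr b)) 0

/-- The gentle algebra `kQ/I` associated to gentle quiver data. -/
abbrev GentleAlg (Q : GentleQuiverData.{u}) : Type u := RingQuot (GentleRel k Q)

section Modules

variable {B : Type u} [Ring B]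

/-- `X` belongs to `add T`: it is a direct summand of a finite direct sum of copies of `T`. -/
def MemAdd (T X : ModuleCat.{u} B) : Prop :=
  ∃ (n : ℕ) (f : X →ₗ[B] (Fin n → T)) (g : (Fin n → T) →ₗ[B] X), g.comp f = LinearMap.id

/-- An indecomposable module: nonzero, and any direct sum decomposition is trivial. -/
def IsIndec (X : ModuleCat.{u} B) : Prop :=
  Nontrivial X ∧ ∀ Y Z : ModuleCat.{u} B,
    Nonempty (X ≃ₗ[B] Y × Z) → Subsingleton Y ∨ Subsingleton Z

/-- `M` decomposes as the direct sum of the family `N` of pairwise non-isomorphic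
indecomposable modules; in particular `M` is multiplicity-free. -/
def IsIndecDecomp (M : ModuleCat.{u} B) {m : ℕ} (N : Fin m → ModuleCat.{u} B) : Prop :=
  (∀ i, IsIndec (N i)) ∧
  (∀ i j, i ≠ j → IsEmpty (N i ≃ₗ[B] N j)) ∧
  Nonempty (M ≃ₗ[B] ((i : Fin m) → N i))

/-- `M` is multiplicity-free with exactly `m` pairwise non-isomorphic indecomposable
direct summands. -/
def HasRank (M : ModuleCat.{u} B) (m : ℕ) : Prop :=
  ∃ N : Fin m → ModuleCat.{u} B, IsIndecDecomp M N

/-- Projective dimension at most `d`held via an explicit projective resolution. -/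
def ProjDimLE : ModuleCat.{u} B → ℕ → Prop
  | X, 0 => Module.Projective B X
  | X, (d + 1) => ∃ P : ModuleCat.{u} B, Module.Projective B P ∧
      ∃ f : P →ₗ[B] X, Function.Surjective f ∧ ProjDimLE (ModuleCat.of B (LinearMap.ker f)) d

/-- (T1): finite projective dimension. -/
def HasFiniteProjDim (X : ModuleCat.{u} B) : Prop := ∃ d, ProjDimLE X d

/-- There is an exact sequence `0 → X → T₀ → ⋯ → T_d → 0` with all `Tᵢ` in `add T`. -/
def CoresolvedBy (T : ModuleCat.{u} B) : ModuleCat.{u} B → ℕ → Prop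
  | X, 0 => MemAdd T X
  | X, (d + 1) => ∃ T₀ : ModuleCat.{u} B, MemAdd T T₀ ∧
      ∃ f : X →ₗ[B] T₀, Function.Injective f ∧
        CoresolvedBy T (ModuleCat.of B (T₀ ⧸ LinearMap.range f)) d

/-- The Ext-group `Ext^n_B(X, Y)`. -/
noncomputable def ExtGroup (X Y : ModuleCat.{u} B) (n : ℕ) : Type (u + 1) :=
  letI : HasDerivedCategory.{u + 1} (ModuleCat.{u} B) := HasDerivedCategory.standard _
  letI : HasExt.{u + 1} (ModuleCat.{u} B) := hasExt_of_hasDerivedCategory _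
  Abelian.Ext X Y n

/-- (T2): `Ext^i(T, T) = 0` for all `i > 0`. -/
def SelfOrthogonal (T : ModuleCat.{u} B) : Prop :=
  ∀ i : ℕ, 0 < i → Subsingleton (ExtGroup T T i)

/-- Pre-tilting: (T1) and (T2). -/
def IsPreTilting (T : ModuleCat.{u} B) : Prop :=
  HasFiniteProjDim T ∧ SelfOrthogonal T

/-- Tilting: (T1), (T2) and (T3) (an `add T`-coresolution of the regular module). -/
def IsTilting (T : ModuleCat.{u} B) : Prop :=
  HasFiniteProjDim T ∧ SelfOrthogonal T ∧ ∃ d, CoresolvedBy T (ModuleCat.of B B) d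

/-- The direct sum `M ⊕ N`. -/
def dSum (M N : ModuleCat.{u} B) : ModuleCat.{u} B := ModuleCat.of B (M × N)

/-- `N` is an (indecomposable) complement to `M`: a finite-dimensional indecomposable module
not in `add M` such that `M ⊕ N` is a tilting module. -/
def IsComplement (M N : ModuleCat.{u} B) : Prop :=
  Module.Finite B N ∧ IsIndec N ∧ ¬ MemAdd M N ∧ IsTilting (dSum M N)

end Modules

set_option linter.unusedSectionVars false

section AddSummands

variable {B : Type u} [Ring B] {T X Y Z : ModuleCat.{u} B}

lemma MemAdd.of_fintype {ι : Type*} [Fintype ι] (f : X →ₗ[B] (ι → T)) (g : (ι → T) →ₗ[B] X)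
    (h : g.comp f = LinearMap.id) : MemAdd T X := by
  let e := LinearEquiv.funCongrLeft B T (Fintype.equivFin ι).symm
  refine ⟨Fintype.card ι, e.toLinearMap.comp f, g.comp e.symm.toLinearMap, ?_⟩
  ext x
  simpa using LinearMap.congr_fun h x

lemma MemAdd.of_retract (f : X →ₗ[B] T) (g : T →ₗ[B] X) (h : g.comp f = LinearMap.id) :
    MemAdd T X :=
  MemAdd.of_fintype (ι := Unit) (LinearMap.pi fun _ => f) (g.comp (LinearMap.proj ()))
    (by ext x; simpa using LinearMap.congr_fun h x)

lemma MemAdd.retract (hY : MemAdd T Y) (f : X →ₗ[B] Y) (g : Y →ₗ[B] X)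
    (h : g.comp f = LinearMap.id) : MemAdd T X := by
  obtain ⟨n, a, b, hab⟩ := hY
  refine ⟨n, a.comp f, g.comp b, ?_⟩
  ext x
  have := LinearMap.congr_fun hab (f x)
  simp only [LinearMap.comp_apply, LinearMap.id_apply] at this ⊢
  rw [this]
  exact LinearMap.congr_fun h x

lemma MemAdd.congr (hY : MemAdd T Y) (e : X ≃ₗ[B] Y) : MemAdd T X :=
  hY.retract e.toLinearMap e.symm.toLinearMap (by ext; simp)

lemma MemAdd.prod (hX : MemAdd T X) (hY : MemAdd T Y) : MemAdd T (ModuleCat.of B (X × Y)) := by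
  obtain ⟨n, a, b, hab⟩ := hX
  obtain ⟨m, c, d, hcd⟩ := hY
  let e := LinearEquiv.sumArrowLequivProdArrow (Fin n) (Fin m) B T
  refine MemAdd.of_fintype (X := ModuleCat.of B (X × Y)) (ι := Fin n ⊕ Fin m)
    (e.symm.toLinearMap.comp (a.prodMap c)) ((b.prodMap d).comp e.toLinearMap) ?_
  refine LinearMap.ext fun x => ?_
  have h1 := LinearMap.congr_fun hab x.1
  have h2 := LinearMap.congr_fun hcd x.2
  simp only [LinearMap.comp_apply, LinearMap.id_apply] at h1 h2
  simp [h1, h2]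

lemma CoresolvedBy.of_shortExact {d : ℕ} (hY : MemAdd T Y) (f : X →ₗ[B] Y)
    (g : Y →ₗ[B] Z) (hf : Function.Injective f) (hg : Function.Surjective g)
    (hfg : LinearMap.range f = LinearMap.ker g)
    (congr : ∀ {Z' : ModuleCat.{u} B}, (Z' ≃ₗ[B] Z) → CoresolvedBy T Z' d) :
    CoresolvedBy T X (d + 1) :=
  ⟨Y, hY, f, hf, congr ((Submodule.quotEquivOfEq _ _ hfg).trans (g.quotKerEquivOfSurjective hg))⟩

lemma CoresolvedBy.congr {d : ℕ} (h : CoresolvedBy T Y d) (e : X ≃ₗ[B] Y) :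
    CoresolvedBy T X d := by
  cases d with
  | zero => exact MemAdd.congr h e
  | succ d =>
    obtain ⟨T₀, hT, f, hf, hd⟩ := h
    refine ⟨T₀, hT, f.comp e.toLinearMap, hf.comp e.injective, ?_⟩
    have : LinearMap.range (f.comp e.toLinearMap) = LinearMap.range f :=
      LinearMap.range_comp_of_range_eq_top f e.range
    rwa [this]

lemma CoresolvedBy.cons {d : ℕ} (hZ : CoresolvedBy T Z d) (hY : MemAdd T Y) (f : X →ₗ[B] Y)
    (g : Y →ₗ[B] Z) (hf : Function.Injective f) (hg : Function.Surjective g)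
    (hfg : LinearMap.range f = LinearMap.ker g) : CoresolvedBy T X (d + 1) :=
  .of_shortExact hY f g hf hg hfg hZ.congr

lemma CoresolvedBy.prod {d : ℕ} (hX : CoresolvedBy T X d) (hY : MemAdd T Y) :
    CoresolvedBy T (ModuleCat.of B (X × Y)) d := by
  cases d with
  | zero => exact MemAdd.prod hX hY
  | succ d =>
    obtain ⟨T₀, hT, f, hf, hd⟩ := hX
    refine CoresolvedBy.cons (X := ModuleCat.of B (X × Y)) hd (hT.prod hY)
      (f.prodMap LinearMap.id) ((LinearMap.range f).mkQ.comp (LinearMap.fst B T₀ Y))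
      (hf.prodMap Function.injective_id)
      ((Submodule.mkQ_surjective _).comp Prod.fst_surjective) ?_
    rw [LinearMap.range_prodMap, LinearMap.ker_comp, Submodule.ker_mkQ, LinearMap.range_id]
    ext ⟨a, b⟩
    simp

lemma ProjDimLE.congr {d : ℕ} (h : ProjDimLE Y d) (e : X ≃ₗ[B] Y) : ProjDimLE X d := by
  cases d with
  | zero =>
    have : Module.Projective B Y := h
    exact Module.Projective.of_equiv e.symm
  | succ d =>
    obtain ⟨P, hP, f, hf, hd⟩ := h
    refine ⟨P, hP, e.symm.toLinearMap.comp f, e.symm.surjective.comp hf, ?_⟩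
    have : LinearMap.ker (e.symm.toLinearMap.comp f) = LinearMap.ker f :=
      LinearMap.ker_comp_of_ker_eq_bot f e.symm.ker
    rwa [this]

lemma ProjDimLE.cons {d : ℕ} (hX : ProjDimLE X d) (hY : Module.Projective B Y) (f : X →ₗ[B] Y)
    (g : Y →ₗ[B] Z) (hf : Function.Injective f) (hg : Function.Surjective g)
    (hfg : LinearMap.range f = LinearMap.ker g) : ProjDimLE Z (d + 1) :=
  ⟨Y, hY, g, hg, hX.congr
    ((LinearEquiv.ofInjective f hf).trans (LinearEquiv.ofEq _ _ hfg)).symm⟩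

lemma ProjDimLE.prod {d : ℕ} (hX : ProjDimLE X d) (hY : Module.Projective B Y) :
    ProjDimLE (ModuleCat.of B (Y × X)) d := by
  cases d with
  | zero =>
    have : Module.Projective B X := hX
    exact inferInstanceAs (Module.Projective B (Y × X))
  | succ d =>
    obtain ⟨P, hP, f, hf, hd⟩ := hX
    refine ProjDimLE.cons (Y := ModuleCat.of B (Y × P)) (Z := ModuleCat.of B (Y × X)) hd
      inferInstance
      ((LinearMap.inr B Y P).comp (LinearMap.ker f).subtype) (LinearMap.id.prodMap f)
      (LinearMap.inr_injective.comp Subtype.val_injective)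
      (Function.surjective_id.prodMap hf) ?_
    rw [LinearMap.ker_prodMap, LinearMap.range_comp, Submodule.range_subtype, LinearMap.ker_id]
    ext ⟨a, b⟩
    simp [eq_comm]

end AddSummands

section ExtVanishing

variable {B : Type u} [Ring B]

open Abelian

lemma extGroup_subsingleton_of_projective (X Y : ModuleCat.{u} B) (hX : Module.Projective B X)
    {i : ℕ} (hi : 0 < i) : Subsingleton (ExtGroup X Y i) := by
  let : HasDerivedCategory.{u + 1} (ModuleCat.{u} B) := HasDerivedCategory.standard _
  let : HasExt.{u + 1} (ModuleCat.{u} B) := hasExt_of_hasDerivedCategory _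
  have : CategoryTheory.Projective X := ModuleCat.projective_of_categoryTheory_projective X
  obtain ⟨i, rfl⟩ := Nat.exists_eq_succ_of_ne_zero hi.ne'
  exact subsingleton_of_forall_eq (0 : Ext X Y (i + 1)) Ext.eq_zero_of_projective

lemma extGroup_subsingleton_of_injective (X Y : ModuleCat.{u} B) (hY : Module.Injective B Y)
    {i : ℕ} (hi : 0 < i) : Subsingleton (ExtGroup X Y i) := by
  let : HasDerivedCategory.{u + 1} (ModuleCat.{u} B) := HasDerivedCategory.standard _
  let : HasExt.{u + 1} (ModuleCat.{u} B) := hasExt_of_hasDerivedCategory _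
  have : CategoryTheory.Injective Y := Module.injective_object_of_injective_module B Y
  obtain ⟨i, rfl⟩ := Nat.exists_eq_succ_of_ne_zero hi.ne'
  exact subsingleton_of_forall_eq (0 : Ext X Y (i + 1)) Ext.eq_zero_of_injective

/-- Dimension shifting along a short exact sequence with projective middle term. -/
lemma extGroup_subsingleton_of_shortExact {X₁ X₂ X₃ : ModuleCat.{u} B} (Y : ModuleCat.{u} B)
    (hX : Module.Projective B X₂) (f : X₁ →ₗ[B] X₂) (g : X₂ →ₗ[B] X₃)
    (hf : Function.Injective f) (hg : Function.Surjective g)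
    (hfg : LinearMap.range f = LinearMap.ker g) (h0 : ∀ φ : X₁ →ₗ[B] Y, φ = 0)
    (h : ∀ i, 0 < i → Subsingleton (ExtGroup X₁ Y i)) {i : ℕ} (hi : 0 < i) :
    Subsingleton (ExtGroup X₃ Y i) := by
  let : HasDerivedCategory.{u + 1} (ModuleCat.{u} B) := HasDerivedCategory.standard _
  let : HasExt.{u + 1} (ModuleCat.{u} B) := hasExt_of_hasDerivedCategory _
  have : CategoryTheory.Projective X₂ := ModuleCat.projective_of_categoryTheory_projective X₂
  let S : ShortComplex (ModuleCat.{u} B) :=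
    ShortComplex.moduleCatMkOfKerLERange (ModuleCat.ofHom f) (ModuleCat.ofHom g) hfg.le
  have hS : S.ShortExact :=
    { exact := by
        rw [ShortComplex.ShortExact.moduleCat_exact_iff_function_exact]
        exact LinearMap.exact_iff.2 hfg.symm
      mono_f := (ModuleCat.mono_iff_injective _).2 hf
      epi_g := (ModuleCat.epi_iff_surjective _).2 hg }
  obtain ⟨i, rfl⟩ := Nat.exists_eq_succ_of_ne_zero hi.ne'
  refine subsingleton_of_forall_eq (0 : Ext X₃ Y (i + 1)) fun x => ?_
  obtain ⟨y, rfl⟩ := Ext.contravariant_sequence_exact₃ hS Y x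
    (Ext.eq_zero_of_projective (P := X₂) _) (add_comm 1 i)
  have hy : y = 0 := by
    cases i with
    | zero =>
      obtain ⟨φ, rfl⟩ := Ext.homEquiv₀.symm.surjective y
      have : φ = 0 := ModuleCat.hom_ext (h0 φ.hom)
      rw [this]
      exact Ext.mk₀_zero _ _
    | succ i =>
      have : Subsingleton (Ext S.X₁ Y (i + 1)) := h (i + 1) i.succ_pos
      exact Subsingleton.elim _ _
  rw [hy]
  exact Ext.comp_zero _ _ _ _ _

lemma extGroup_dSum_subsingleton {M N : ModuleCat.{u} B} {i : ℕ} (hi : 0 < i)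
    (hMp : Module.Projective B M) (hMi : Module.Injective B M)
    (hN : Subsingleton (ExtGroup N N i)) : Subsingleton (ExtGroup (dSum M N) (dSum M N) i) := by
  let : HasDerivedCategory.{u + 1} (ModuleCat.{u} B) := HasDerivedCategory.standard _
  let : HasExt.{u + 1} (ModuleCat.{u} B) := hasExt_of_hasDerivedCategory _
  let p : dSum M N ⟶ M := ModuleCat.ofHom (LinearMap.fst B M N)
  let q : dSum M N ⟶ N := ModuleCat.ofHom (LinearMap.snd B M N)
  let a : M ⟶ dSum M N := ModuleCat.ofHom (LinearMap.inl B M N)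
  let b : N ⟶ dSum M N := ModuleCat.ofHom (LinearMap.inr B M N)
  have hid : p ≫ a + q ≫ b = 𝟙 _ := ModuleCat.hom_ext <| LinearMap.ext fun x : M × N =>
    Prod.ext (add_zero x.1) (zero_add x.2)
  have h1 (Y : ModuleCat.{u} B) : Subsingleton (Ext M Y i) :=
    extGroup_subsingleton_of_projective M Y hMp hi
  have h2 (Y : ModuleCat.{u} B) : Subsingleton (Ext Y M i) :=
    extGroup_subsingleton_of_injective Y M hMi hi
  have h3 : Subsingleton (Ext N N i) := hN
  have h4 : Subsingleton (Ext N (dSum M N) i) := by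
    refine subsingleton_of_forall_eq 0 fun x => ?_
    rw [← Ext.comp_mk₀_id x, ← hid, Ext.mk₀_add, Ext.comp_add, ← Ext.mk₀_comp_mk₀,
      ← Ext.mk₀_comp_mk₀, ← Ext.comp_assoc_of_third_deg_zero,
      ← Ext.comp_assoc_of_third_deg_zero,
      Subsingleton.elim (x.comp (Ext.mk₀ p) (add_zero i)) 0,
      Subsingleton.elim (x.comp (Ext.mk₀ q) (add_zero i)) 0]
    simp
  change Subsingleton (Ext (dSum M N) (dSum M N) i)
  refine subsingleton_of_forall_eq 0 fun x => ?_
  rw [← Ext.mk₀_id_comp x, ← hid, Ext.mk₀_add, Ext.add_comp, ← Ext.mk₀_comp_mk₀_assoc,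
    ← Ext.mk₀_comp_mk₀_assoc, Subsingleton.elim ((Ext.mk₀ a).comp x (zero_add i)) 0,
    Subsingleton.elim ((Ext.mk₀ b).comp x (zero_add i)) 0]
  simp

end ExtVanishing

section Indecomposable

variable {B : Type u} [Ring B] {X U : ModuleCat.{u} B}

lemma IsIndec.equiv_of_retract [Nontrivial U] (hX : IsIndec X) (f : U →ₗ[B] X) (g : X →ₗ[B] U)
    (h : g.comp f = LinearMap.id) : Nonempty (X ≃ₗ[B] U) := by
  have hf : Function.Injective f :=
    Function.LeftInverse.injective (g := g) (LinearMap.congr_fun h)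
  have hc : IsCompl (LinearMap.range f) (LinearMap.ker g) := by
    have hp := LinearMap.isCompl_of_proj (p := LinearMap.range f)
      (f := (LinearEquiv.ofInjective f hf).toLinearMap.comp g) (by
        rintro ⟨_, x, rfl⟩
        ext
        simpa using congrArg f (LinearMap.congr_fun h x))
    rwa [LinearEquiv.ker_comp] at hp
  have e := (Submodule.prodEquivOfIsCompl _ _ hc).symm.trans
    ((LinearEquiv.ofInjective f hf).symm.prodCongr (LinearEquiv.refl B _))
  rcases hX.2 U (ModuleCat.of B (LinearMap.ker g)) ⟨e⟩ with h1 | h1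
  · exact absurd h1 (not_subsingleton U)
  · have : Subsingleton (LinearMap.ker g) := h1
    exact ⟨LinearEquiv.ofBijective g ⟨LinearMap.ker_eq_bot.1 (Submodule.eq_bot_of_subsingleton),
      Function.RightInverse.surjective (LinearMap.congr_fun h)⟩⟩

end Indecomposable

/-- The cyclic quiver on the vertex set `V`, with arrows `v ⟶ v + 1`, in which all paths of
length two vanish except the one starting at `0`. -/
@[reducible] def cyclicQuiver (V : Type u) [CommRing V] [Fintype V] : GentleQuiverData.{u} where
  V := V
  E := V
  fintV := inferInstance
  fintE := inferInstance
  src := fun v => v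
  tgt := fun v => v + 1
  rel := fun a b => a + 1 = b ∧ a ≠ 0
  rel_comp := fun _ _ h => h.1
  src_le_two := fun v => by
    have : {a : V | a = v} = {v} := by ext; simp
    rw [this, Set.ncard_singleton]; norm_num
  tgt_le_two := fun v => by
    have : {a : V | a + 1 = v} = {v - 1} := by ext; simp [eq_sub_iff_add_eq]
    rw [this, Set.ncard_singleton]; norm_num
  rel_right_unique := fun _ _ _ h h' => h.1.symm.trans h'.1
  rel_left_unique := fun _ _ _ h h' => add_right_cancel (h.1.trans h'.1.symm)
  nonrel_right_unique := fun _ _ _ h _ h' _ => h.symm.trans h'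
  nonrel_left_unique := fun _ _ _ h _ h' _ => add_right_cancel (h.trans h'.symm)

namespace CyclicGentle

open MulOpposite

variable (k : Type u) [Field k] (V : Type u) [CommRing V] [Fintype V]

/-- Left modules over this ring are right modules over the gentle algebra of `cyclicQuiver V`. -/
abbrev OpAlg : Type u := (GentleAlg k (cyclicQuiver V))ᵐᵒᵖ

variable {V}

/-- The idempotent of a vertex. -/
def idem (v : V) : OpAlg k V :=
  op (RingQuot.mkAlgHom k (GentleRel k (cyclicQuiver V)) (FreeAlgebra.ι k (Sum.inl v)))

/-- A single arrow. -/
def arrow (v : V) : OpAlg k V :=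
  op (RingQuot.mkAlgHom k (GentleRel k (cyclicQuiver V)) (FreeAlgebra.ι k (Sum.inr v)))

variable (V) in
/-- The sum of all arrows. -/
def shift : OpAlg k V := ∑ v : V, arrow k v

lemma idem_mul_self (v : V) : idem k v * idem k v = idem k v := by
  unfold idem
  rw [← op_mul, ← map_mul]
  exact congrArg op (RingQuot.mkAlgHom_rel k (GentleRel.idem (k := k) (Q := cyclicQuiver V) v))

lemma idem_mul_of_ne {v w : V} (h : v ≠ w) : idem k v * idem k w = 0 := by
  unfold idem
  rw [← op_mul, ← map_mul]
  exact (congrArg op (RingQuot.mkAlgHom_rel k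
    (GentleRel.orth (k := k) (Q := cyclicQuiver V) w v h.symm))).trans (by simp)

variable (V) in
lemma sum_idem : ∑ v : V, idem k v = 1 := by
  unfold idem
  rw [← op_one, ← map_one (RingQuot.mkAlgHom k (GentleRel k (cyclicQuiver V))),
    ← RingQuot.mkAlgHom_rel k (GentleRel.sum_idem (k := k) (Q := cyclicQuiver V)), map_sum,
    Finset.op_sum]

lemma arrow_mul_idem_self (v : V) : arrow k v * idem k v = arrow k v := by
  unfold idem arrow
  rw [← op_mul, ← map_mul]
  exact congrArg op (RingQuot.mkAlgHom_rel k (GentleRel.src_mul (k := k) (Q := cyclicQuiver V) v))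

lemma idem_mul_arrow_self (v : V) : idem k (v + 1) * arrow k v = arrow k v := by
  unfold idem arrow
  rw [← op_mul, ← map_mul]
  exact congrArg op (RingQuot.mkAlgHom_rel k (GentleRel.mul_tgt (k := k) (Q := cyclicQuiver V) v))

lemma arrow_mul_arrow {v : V} (h : v ≠ 0) : arrow k (v + 1) * arrow k v = 0 := by
  unfold arrow
  rw [← op_mul, ← map_mul]
  exact (congrArg op (RingQuot.mkAlgHom_rel k
    (GentleRel.relation (k := k) (Q := cyclicQuiver V) v (v + 1) ⟨rfl, h⟩))).trans (by simp)

lemma shift_mul_idem (v : V) : shift k V * idem k v = arrow k v := by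
  classical
  unfold shift
  rw [Finset.sum_mul, Finset.sum_eq_single v, arrow_mul_idem_self]
  · intro w _ h
    rw [← arrow_mul_idem_self, mul_assoc, idem_mul_of_ne k h, mul_zero]
  · simp

lemma idem_mul_shift (v : V) : idem k (v + 1) * shift k V = arrow k v := by
  classical
  unfold shift
  rw [Finset.mul_sum, Finset.sum_eq_single v, idem_mul_arrow_self]
  · intro w _ h
    rw [← idem_mul_arrow_self, ← mul_assoc, idem_mul_of_ne k (by simpa using h.symm), zero_mul]
  · simp

lemma shift_comm (v : V) : shift k V * idem k v = idem k (v + 1) * shift k V := by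
  rw [shift_mul_idem, idem_mul_shift]

lemma shift_pow_comm (s : ℕ) (v : V) :
    shift k V ^ s * idem k v = idem k (v + s) * shift k V ^ s := by
  induction s generalizing v with
  | zero => simp
  | succ s ih =>
    rw [pow_succ, mul_assoc, shift_comm, ← mul_assoc, ih, mul_assoc]
    congr 2; push_cast; ring

lemma shift_sq_mul_idem {v : V} (h : v ≠ 0) : shift k V ^ 2 * idem k v = 0 := by
  rw [sq, mul_assoc, shift_mul_idem, ← idem_mul_arrow_self, ← mul_assoc, shift_mul_idem,
    arrow_mul_arrow k h]

variable (V) in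
lemma shift_pow_three [Nontrivial V] : shift k V ^ 3 = 0 := by
  rw [← mul_one (shift k V ^ 3), ← sum_idem, Finset.mul_sum]
  refine Finset.sum_eq_zero fun v _ => ?_
  by_cases h : v = 0
  · rw [show 3 = 2 + 1 from rfl, pow_add, pow_one, mul_assoc, shift_comm, ← mul_assoc,
      shift_sq_mul_idem k (by simp [h]), zero_mul]
  · rw [show 3 = 1 + 2 from rfl, pow_add, mul_assoc, shift_sq_mul_idem k h, mul_zero]

/-- The algebra is generated by the vertices and the sum of all arrows. -/
lemma adjoin_eq_top :
    Algebra.adjoin k (Set.range (idem k (V := V)) ∪ {shift k V}) = ⊤ := by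
  set S := Algebra.adjoin k (Set.range (idem k (V := V)) ∪ {shift k V})
  have hi (v : V) : idem k v ∈ S := Algebra.subset_adjoin (Or.inl ⟨v, rfl⟩)
  have hs : shift k V ∈ S := Algebra.subset_adjoin (Or.inr rfl)
  have key (x : FreeAlgebra k (V ⊕ V)) :
      op (RingQuot.mkAlgHom k (GentleRel k (cyclicQuiver V)) x) ∈ S := by
    induction x with
    | grade0 r =>
      rw [AlgHom.commutes]
      exact S.algebraMap_mem r
    | grade1 x =>
      rcases x with v | v
      · exact hi v
      · have := S.mul_mem hs (hi v)
        rwa [shift_mul_idem] at this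
    | mul x y hx hy =>
      rw [map_mul, op_mul]
      exact S.mul_mem hy hx
    | add x y hx hy =>
      rw [map_add, MulOpposite.op_add]
      exact S.add_mem hx hy
  rw [eq_top_iff]
  rintro x -
  obtain ⟨y, hy⟩ := RingQuot.mkAlgHom_surjective k (GentleRel k (cyclicQuiver V)) x.unop
  have := key y
  rwa [hy, op_unop] at this

section Lift

variable {k} {W : Type u} [AddCommGroup W] [Module k W]

/-- The representation defined by compatible operators. -/
def lift (e : V → Module.End k W) (a : Module.End k W)
    (he : ∀ v, e v * e v = e v) (hne : ∀ v w, v ≠ w → e v * e w = 0) (hsum : ∑ v, e v = 1)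
    (hcomm : ∀ v, a * e v = e (v + 1) * a) (hsq : ∀ v, v ≠ 0 → a * a * e v = 0) :
    OpAlg k V →ₐ[k] Module.End k W :=
  AlgHom.opComm <| RingQuot.liftAlgHom k ⟨FreeAlgebra.lift k
    (Sum.elim (fun v => op (e v)) (fun v => op (a * e v))), by
      intro x y (h : GentleRel k (cyclicQuiver V) x y)
      induction h with
      | idem v => simp [← op_mul, he]
      | orth v w h => simp [← op_mul, hne w v h.symm]
      | sum_idem => simp [← Finset.op_sum, hsum]
      | src_mul v => simp [← op_mul, mul_assoc, he]
      | mul_tgt v => simp [← op_mul, hcomm, ← mul_assoc, he]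
      | relation v w h =>
        obtain ⟨rfl, h0⟩ := h
        simp only [map_mul, FreeAlgebra.lift_ι_apply, Sum.elim_inr, ← op_mul, map_zero,
          op_eq_zero_iff]
        rw [hcomm v, mul_assoc, ← mul_assoc (e (v + 1)), he, ← hcomm, ← mul_assoc, hsq v h0]⟩

variable (e : V → Module.End k W) (a : Module.End k W)
    (he : ∀ v, e v * e v = e v) (hne : ∀ v w, v ≠ w → e v * e w = 0) (hsum : ∑ v, e v = 1)
    (hcomm : ∀ v, a * e v = e (v + 1) * a) (hsq : ∀ v, v ≠ 0 → a * a * e v = 0)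

lemma lift_idem (v : V) : lift e a he hne hsum hcomm hsq (idem k v) = e v := by
  simp [lift, idem]

lemma lift_arrow (v : V) : lift e a he hne hsum hcomm hsq (arrow k v) = a * e v := by
  simp [lift, arrow]

lemma lift_shift : lift e a he hne hsum hcomm hsq (shift k V) = a := by
  rw [shift, map_sum]
  simp only [lift_arrow]
  rw [← Finset.mul_sum, hsum, mul_one]

end Lift

end CyclicGentle

namespace CyclicGentle

/-- A segment of the cyclic quiver: a non-zero path, given by its starting vertex and its number
of vertices. -/
structure Seg (V : Type u) [Zero V] where
  /-- the first vertex -/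
  start : V
  /-- the number of vertices -/
  len : ℕ
  pos : 0 < len
  ok : len ≤ 2 ∨ len ≤ 3 ∧ start = 0

variable (k : Type u) [Field k] {V : Type u} [CommRing V] [Fintype V]

/-- The uniserial module supported on a segment. -/
def SegMod (s : Seg V) : Type u := Fin s.len → k

namespace SegMod

variable (s : Seg V)

instance : AddCommGroup (SegMod k s) := inferInstanceAs (AddCommGroup (Fin s.len → k))

instance : Module k (SegMod k s) := inferInstanceAs (Module k (Fin s.len → k))

instance : Module.Finite k (SegMod k s) := inferInstanceAs (Module.Finite k (Fin s.len → k))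

open Classical in
/-- The action of the idempotent at a vertex. -/
noncomputable def idemEnd (v : V) : Module.End k (SegMod k s) where
  toFun f := fun t => if s.start + (t : ℕ) = v then f t else 0
  map_add' f g := by
    funext t
    change (if _ then f t + g t else 0) = (if _ then f t else 0) + (if _ then g t else 0)
    split_ifs <;> simp
  map_smul' c f := by
    funext t
    change (if _ then c * f t else 0) = c * (if _ then f t else 0)
    split_ifs <;> simp

/-- The action of the sum of all arrows. -/
def shiftEnd : Module.End k (SegMod k s) where
  toFun f := fun t => if t.val = 0 then 0 else f ⟨t.val - 1, by omega⟩
  map_add' f g := by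
    funext t
    change (if _ then 0 else f _ + g _) = (if _ then 0 else f _) + (if _ then 0 else g _)
    split_ifs <;> simp
  map_smul' c f := by
    funext t
    change (if _ then 0 else c * f _) = c * (if _ then 0 else f _)
    split_ifs <;> simp

open Classical in
lemma idemEnd_apply (v : V) (f : SegMod k s) (t : Fin s.len) :
    idemEnd k s v f t = if s.start + (t : ℕ) = v then f t else 0 := rfl

lemma shiftEnd_apply (f : SegMod k s) (t : Fin s.len) :
    shiftEnd k s f t = if t.val = 0 then 0 else f ⟨t.val - 1, by omega⟩ := rfl

/-- The representation on a segment. -/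
noncomputable def rep : OpAlg k V →ₐ[k] Module.End k (SegMod k s) :=
  lift (idemEnd k s) (shiftEnd k s)
    (fun v => by
      refine LinearMap.ext fun f => funext fun t => ?_
      simp only [Module.End.mul_apply, idemEnd_apply]
      split_ifs <;> rfl)
    (fun v w h => by
      refine LinearMap.ext fun f => funext fun t => ?_
      simp only [Module.End.mul_apply, idemEnd_apply]
      split_ifs with h1 h2
      · exact absurd (h1.symm.trans h2) h
      · rfl
      · rfl)
    (by
      refine LinearMap.ext fun f => funext fun t => ?_
      rw [LinearMap.sum_apply]
      refine (Finset.sum_apply (M := fun _ => k) t Finset.univ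
        (fun v => idemEnd k s v f)).trans ?_
      classical
      simp [idemEnd_apply])
    (fun v => by
      refine LinearMap.ext fun f => funext fun t => ?_
      simp only [Module.End.mul_apply, idemEnd_apply, shiftEnd_apply]
      have (ht : t.val ≠ 0) : (t.val : V) = ((t.val - 1 : ℕ) : V) + 1 := by
        rw [← Nat.cast_succ]; congr 1; omega
      by_cases h1 : t.val = 0
      · split_ifs <;> rfl
      · have h2 : s.start + ((t.val - 1 : ℕ) : V) = v ↔ s.start + (t.val : V) = v + 1 := by
          rw [this h1, ← add_assoc, add_left_inj]
        split_ifs with h3 h4 h4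
        · rfl
        · exact absurd (h2.1 h3) h4
        · exact absurd (h2.2 h4) h3
        · rfl)
    (fun v hv => by
      refine LinearMap.ext fun f => funext fun t => ?_
      simp only [Module.End.mul_apply, idemEnd_apply, shiftEnd_apply]
      split_ifs with h1 h2 h3
      · rfl
      · rfl
      · rcases s.ok with h | h
        · have := t.2
          omega
        · have : t.val - 1 - 1 = 0 := by have := t.2; omega
          simp [this, h.2] at h3
          exact absurd h3.symm hv
      · rfl)

noncomputable instance : Module (OpAlg k V) (SegMod k s) :=
  Module.compHom _ (rep k s).toRingHom

lemma smul_def (r : OpAlg k V) (f : SegMod k s) : r • f = rep k s r f := rfl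

instance : IsScalarTower k (OpAlg k V) (SegMod k s) where
  smul_assoc c r f := by rw [smul_def, smul_def, map_smul]; rfl

instance : Module.Finite (OpAlg k V) (SegMod k s) :=
  Module.Finite.of_restrictScalars_finite k _ _

variable {k s}

open Classical in
lemma idem_smul_apply (v : V) (f : SegMod k s) (t : Fin s.len) :
    (idem k v • f) t = if s.start + (t : ℕ) = v then f t else 0 := by
  rw [smul_def, rep, lift_idem, idemEnd_apply]

lemma shift_smul_apply (f : SegMod k s) (t : Fin s.len) :
    (shift k V • f) t = if t.val = 0 then 0 else f ⟨t.val - 1, by omega⟩ := by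
  rw [smul_def, rep, lift_shift, shiftEnd_apply]

lemma shift_pow_smul_apply (n : ℕ) (f : SegMod k s) (t : Fin s.len) :
    (shift k V ^ n • f) t = if t.val < n then 0 else f ⟨t.val - n, by omega⟩ := by
  induction n generalizing f with
  | zero => simp
  | succ n ih =>
    rw [pow_succ, mul_smul, ih, shift_smul_apply]
    split_ifs with h1 h2 h3 h4 <;> first | rfl | (exfalso; simp at *; omega)

lemma shift_pow_len_smul (f : SegMod k s) : shift k V ^ s.len • f = 0 := by
  funext t
  rw [shift_pow_smul_apply, if_pos t.2]
  rfl

/-- The standard basis vectors. -/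
def basis (s : Seg V) (t : Fin s.len) : SegMod k s := (Pi.single t 1 : Fin s.len → k)

lemma basis_apply (t t' : Fin s.len) :
    (basis s t : SegMod k s) t' = if t' = t then 1 else 0 := Pi.single_apply _ _ _

/-- The top of a segment. -/
def top (s : Seg V) : SegMod k s := basis s ⟨0, s.pos⟩

/-- The socle of a segment. -/
def bot (s : Seg V) : SegMod k s := basis s ⟨s.len - 1, Nat.sub_lt s.pos one_pos⟩

lemma bot_ne_zero : (bot s : SegMod k s) ≠ 0 := fun h => by
  have := congrFun h ⟨s.len - 1, Nat.sub_lt s.pos one_pos⟩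
  rw [bot, basis_apply, if_pos rfl] at this
  exact one_ne_zero this

lemma shift_pow_smul_top (t : Fin s.len) :
    shift k V ^ (t : ℕ) • (top s : SegMod k s) = basis s t := by
  funext t'
  rw [shift_pow_smul_apply, top, basis_apply, basis_apply]
  simp only [Fin.ext_iff]
  split_ifs <;> first | rfl | (exfalso; omega)

lemma idem_smul_basis_self (t : Fin s.len) :
    idem k (s.start + (t : ℕ)) • (basis s t : SegMod k s) = basis s t := by
  funext t'
  rw [idem_smul_apply, basis_apply]
  split_ifs with h1 h2 h2
  · rfl
  · rfl
  · exact absurd (by rw [h2]) h1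
  · rfl

lemma idem_smul_basis_of_ne (t : Fin s.len) {v : V} (h : s.start + (t : ℕ) ≠ v) :
    idem k v • (basis s t : SegMod k s) = 0 := by
  funext t'
  rw [idem_smul_apply, basis_apply]
  split_ifs with h1 h2
  · exact absurd (by rw [← h1, h2]) h
  · rfl
  · rfl

lemma idem_smul_top : idem k s.start • (top s : SegMod k s) = top s := by
  have := idem_smul_basis_self (k := k) (⟨0, s.pos⟩ : Fin s.len)
  rwa [Nat.cast_zero, add_zero] at this

lemma eq_sum_basis (f : SegMod k s) : f = ∑ t, f t • basis s t := by
  refine (pi_eq_sum_univ' (R := k) (ι := Fin s.len) f).trans ?_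
  rfl

/-- The socle is one-dimensional. -/
lemma eq_smul_bot {f : SegMod k s} (h : shift k V • f = 0) :
    f = f ⟨s.len - 1, Nat.sub_lt s.pos one_pos⟩ • bot s := by
  funext t
  change f t = _ * (bot s : SegMod k s) t
  rw [bot, basis_apply]
  split_ifs with h1
  · rw [mul_one, h1]
  · rw [Fin.ext_iff] at h1
    have h2 := congrFun h ⟨t.val + 1, by simp at h1; omega⟩
    rw [shift_smul_apply, if_neg (Nat.succ_ne_zero _)] at h2
    exact h2.trans (mul_zero _).symm

end SegMod

section Hom

variable {k} {X Y : Type u} [AddCommGroup X] [Module k X] [Module (OpAlg k V) X]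
  [IsScalarTower k (OpAlg k V) X] [AddCommGroup Y] [Module k Y] [Module (OpAlg k V) Y]
  [IsScalarTower k (OpAlg k V) Y]

/-- A linear map commuting with the generators is a module homomorphism. -/
def homMk (f : X →ₗ[k] Y) (he : ∀ (v : V) x, f (idem k v • x) = idem k v • f x)
    (hs : ∀ x, f (shift k V • x) = shift k V • f x) : X →ₗ[OpAlg k V] Y where
  toFun := f
  map_add' := map_add f
  map_smul' r x := by
    have hr : r ∈ Algebra.adjoin k (Set.range (idem k (V := V)) ∪ {shift k V}) := by
      rw [adjoin_eq_top]; trivial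
    simp only [RingHom.id_apply]
    induction hr using Algebra.adjoin_induction generalizing x with
    | mem r hr =>
      rcases hr with ⟨v, rfl⟩ | rfl
      · exact he v x
      · exact hs x
    | algebraMap c => rw [algebraMap_smul, algebraMap_smul, map_smul]
    | add r r' _ _ h h' => rw [add_smul, map_add, h, h', add_smul]
    | mul r r' _ _ h h' => rw [mul_smul, h, h', mul_smul]

@[simp] lemma homMk_apply (f : X →ₗ[k] Y) (he : ∀ (v : V) x, f (idem k v • x) = idem k v • f x)
    (hs : ∀ x, f (shift k V • x) = shift k V • f x) (x : X) : homMk f he hs x = f x := rfl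

lemma map_smul_field (f : X →ₗ[OpAlg k V] Y) (c : k) (x : X) : f (c • x) = c • f x := by
  rw [← algebraMap_smul (OpAlg k V), map_smul, algebraMap_smul]

variable {s : Seg V}

lemma SegMod.induction {p : SegMod k s → Prop} (f : SegMod k s)
    (hadd : ∀ f g, p f → p g → p (f + g)) (h0 : p 0)
    (h : ∀ (c : k) (t : Fin s.len), p (c • basis s t)) : p f := by
  rw [SegMod.eq_sum_basis f]
  exact Finset.sum_induction _ p hadd h0 fun t _ => h _ t

lemma SegMod.hom_ext {f g : SegMod k s →ₗ[OpAlg k V] X} (h : f (top s) = g (top s)) : f = g := by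
  ext x
  induction x using SegMod.induction with
  | hadd x y hx hy => rw [map_add, map_add, hx, hy]
  | h0 => simp
  | h c t =>
    rw [map_smul_field, map_smul_field, ← SegMod.shift_pow_smul_top, map_smul, map_smul, h]

lemma smul_field_comm (c : k) (r : OpAlg k V) (x : X) : c • r • x = r • c • x :=
  haveI : SMulCommClass k (OpAlg k V) X := IsScalarTower.to_smulCommClass
  smul_comm c r x

lemma idem_smul_shift_pow (v : V) (n : ℕ) (x : X) :
    idem k (v + n) • shift k V ^ n • x = shift k V ^ n • idem k v • x := by
  rw [← mul_smul, ← shift_pow_comm, mul_smul]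

/-- The linear map underlying `ofTop`. -/
noncomputable def ofTopAux (s : Seg V) (x : X) : SegMod k s →ₗ[k] X :=
  Fintype.linearCombination k (fun t : Fin s.len => shift k V ^ (t : ℕ) • idem k s.start • x)

lemma ofTopAux_basis (s : Seg V) (x : X) (t : Fin s.len) :
    ofTopAux s x (SegMod.basis s t : SegMod k s) = shift k V ^ (t : ℕ) • idem k s.start • x :=
  (Fintype.linearCombination_apply_single k _ t 1).trans (one_smul _ _)

/-- The homomorphism out of a segment module determined by the image of its top. -/
noncomputable def ofTop (s : Seg V) (x : X) (h : shift k V ^ s.len • idem k s.start • x = 0) :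
    SegMod k s →ₗ[OpAlg k V] X :=
  homMk (ofTopAux s x)
    (fun v f => by
      induction f using SegMod.induction with
      | hadd f g hf hg => rw [smul_add, map_add, map_add, hf, hg, smul_add]
      | h0 => simp
      | h c t =>
        rw [← smul_field_comm, LinearMap.map_smul, LinearMap.map_smul, ← smul_field_comm,
          ofTopAux_basis]
        congr 1
        by_cases hv : s.start + (t : ℕ) = v
        · subst hv
          rw [SegMod.idem_smul_basis_self, idem_smul_shift_pow, ← mul_smul (idem k s.start),
            idem_mul_self, ofTopAux_basis]
        · rw [SegMod.idem_smul_basis_of_ne t hv, map_zero, ← mul_smul, ← mul_smul, mul_assoc,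
            shift_pow_comm, ← mul_assoc, idem_mul_of_ne k (Ne.symm hv), zero_mul, zero_smul])
    (fun f => by
      induction f using SegMod.induction with
      | hadd f g hf hg => rw [smul_add, map_add, map_add, hf, hg, smul_add]
      | h0 => simp
      | h c t =>
        rw [← smul_field_comm, LinearMap.map_smul, LinearMap.map_smul, ← smul_field_comm,
          ofTopAux_basis,
          ← SegMod.shift_pow_smul_top, ← mul_smul, ← mul_smul, ← pow_succ']
        congr 1
        by_cases ht : t.val + 1 < s.len
        · rw [SegMod.shift_pow_smul_top ⟨t.val + 1, ht⟩, ofTopAux_basis]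
        · have ht : t.val + 1 = s.len := by omega
          rw [ht, SegMod.shift_pow_len_smul, map_zero, h])

lemma ofTop_basis (s : Seg V) (x : X) (h : shift k V ^ s.len • idem k s.start • x = 0)
    (t : Fin s.len) :
    ofTop s x h (SegMod.basis s t) = shift k V ^ (t : ℕ) • idem k s.start • x :=
  ofTopAux_basis s x t

lemma ofTop_top (s : Seg V) (x : X) (h : shift k V ^ s.len • idem k s.start • x = 0) :
    ofTop s x h (SegMod.top s : SegMod k s) = idem k s.start • x := by
  rw [SegMod.top, ofTop_basis, pow_zero, one_smul]

/-- The homomorphism into a segment module determined by a linear functional on the vertex of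
its socle. -/
noncomputable def toBot (s : Seg V) (φ : X →ₗ[k] k)
    (h : ∀ x : X, idem k (s.start + (s.len - 1 : ℕ)) • shift k V ^ s.len • x = 0) :
    X →ₗ[OpAlg k V] SegMod k s :=
  homMk
    { toFun x := fun t =>
        φ (idem k (s.start + (s.len - 1 : ℕ)) • shift k V ^ (s.len - 1 - t.val) • x)
      map_add' x y := by
        funext t
        change _ = φ _ + φ _
        rw [← map_add, smul_add, smul_add]
      map_smul' c x := by
        funext t
        change _ = c • φ _
        rw [← map_smul, ← smul_field_comm, ← smul_field_comm] }
    (fun v x => by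
      funext t
      have e : s.start + ((s.len - 1 : ℕ) : V) =
          s.start + (t : ℕ) + (s.len - 1 - t.val : ℕ) := by
        rw [add_assoc, ← Nat.cast_add]; congr 2; omega
      by_cases hv : s.start + (t : ℕ) = v
      · rw [SegMod.idem_smul_apply, if_pos hv]
        change φ _ = φ _
        rw [e, idem_smul_shift_pow, idem_smul_shift_pow, ← mul_smul (idem k _), hv, idem_mul_self]
      · rw [SegMod.idem_smul_apply, if_neg hv]
        change φ _ = 0
        rw [e, idem_smul_shift_pow, ← mul_smul (idem k _), idem_mul_of_ne k hv, zero_smul,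
          smul_zero, map_zero])
    (fun x => by
      funext t
      rw [SegMod.shift_smul_apply]
      change φ _ = if _ then 0 else φ _
      rw [← mul_smul (shift k V ^ _), ← pow_succ]
      split_ifs with ht
      · rw [ht, show s.len - 1 - 0 + 1 = s.len by have := s.pos; omega, h, map_zero]
      · rw [show s.len - 1 - t.val + 1 = s.len - 1 - (t.val - 1) by omega])

lemma toBot_apply (s : Seg V) (φ : X →ₗ[k] k)
    (h : ∀ x : X, idem k (s.start + (s.len - 1 : ℕ)) • shift k V ^ s.len • x = 0) (x : X)
    (t : Fin s.len) : toBot s φ h x t =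
      φ (idem k (s.start + (s.len - 1 : ℕ)) • shift k V ^ (s.len - 1 - t.val) • x) := rfl

end Hom

end CyclicGentle

namespace CyclicGentle

variable {k : Type u} [Field k] {V : Type u} [CommRing V] [Fintype V]

variable (k) in
lemma idem_mul_shift_sq {w : V} (h : w ≠ 2) : idem k w * shift k V ^ 2 = 0 := by
  have h1 := shift_pow_comm k 2 (w - 2)
  rw [Nat.cast_ofNat, sub_add_cancel] at h1
  rw [← h1, shift_sq_mul_idem k (sub_ne_zero.2 h)]

namespace SegMod

variable {s s' s'' : Seg V}

lemma shift_pow_smul_top_eq_bot : shift k V ^ (s.len - 1) • (top s : SegMod k s) = bot s :=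
  shift_pow_smul_top ⟨s.len - 1, Nat.sub_lt s.pos one_pos⟩

lemma exists_smul_eq_bot [Nontrivial V] {x : SegMod k s} (hx : x ≠ 0) :
    ∃ r : OpAlg k V, r • x = bot s := by
  obtain ⟨r, hr, hr'⟩ : ∃ r : OpAlg k V, r • x ≠ 0 ∧ shift k V • r • x = 0 := by
    by_cases h1 : shift k V • x = 0
    · exact ⟨1, by rwa [one_smul], by rwa [one_smul]⟩
    by_cases h2 : shift k V • shift k V • x = 0
    · exact ⟨shift k V, h1, h2⟩
    refine ⟨shift k V ^ 2, by rwa [sq, mul_smul], ?_⟩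
    rw [← mul_smul, ← pow_succ', shift_pow_three, zero_smul]
  have h := eq_smul_bot hr'
  set c := (r • x) ⟨s.len - 1, Nat.sub_lt s.pos one_pos⟩
  have hc : c ≠ 0 := by
    rintro hc
    rw [hc, zero_smul] at h
    exact hr h
  refine ⟨algebraMap k _ c⁻¹ * r, ?_⟩
  rw [mul_smul, algebraMap_smul, h, smul_smul, inv_mul_cancel₀ hc, one_smul]

lemma injective_of_bot [Nontrivial V] {Y : Type*} [AddCommGroup Y] [Module (OpAlg k V) Y]
    (f : SegMod k s →ₗ[OpAlg k V] Y) (h : f (bot s) ≠ 0) : Function.Injective f := by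
  rw [← LinearMap.ker_eq_bot, LinearMap.ker_eq_bot']
  intro x hx
  by_contra hx0
  obtain ⟨r, hr⟩ := exists_smul_eq_bot hx0
  rw [← hr, map_smul, hx, smul_zero] at h
  exact h rfl

instance : Nontrivial (SegMod k s) := ⟨⟨_, _, bot_ne_zero⟩⟩

lemma isIndec [Nontrivial V] : IsIndec (ModuleCat.of (OpAlg k V) (SegMod k s)) := by
  refine ⟨inferInstanceAs (Nontrivial (SegMod k s)), fun Y Z ⟨e⟩ => ?_⟩
  by_contra! h
  have := h.1
  have := h.2
  obtain ⟨y, hy⟩ := exists_ne (0 : Y)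
  obtain ⟨z, hz⟩ := exists_ne (0 : Z)
  obtain ⟨r, hr⟩ := exists_smul_eq_bot (k := k) (s := s) (x := e.symm (y, 0)) (by simpa using hy)
  obtain ⟨r', hr'⟩ := exists_smul_eq_bot (k := k) (s := s) (x := e.symm (0, z)) (by simpa using hz)
  have h1 : e (bot s) = (r • y, 0) := by
    rw [← hr]; exact (map_smul e r _).trans (by simp)
  have h2 : e (bot s) = (0, r' • z) := by
    rw [← hr']; exact (map_smul e r' _).trans (by simp)
  have h3 : e (bot s) = 0 :=
    Prod.ext ((congrArg Prod.fst h2 :) : (e (bot s)).1 = 0) (congrArg Prod.snd h1 :)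
  exact bot_ne_zero (e.map_eq_zero_iff.1 h3)

lemma len_le_of_equiv (e : SegMod k s ≃ₗ[OpAlg k V] SegMod k s') : s'.len ≤ s.len := by
  by_contra! h
  apply bot_ne_zero (k := k) (s := s')
  rw [← shift_pow_smul_top_eq_bot, show s'.len - 1 = (s'.len - 1 - s.len) + s.len by omega,
    pow_add, mul_smul, ← e.apply_symm_apply (top s'), ← map_smul, ← map_smul,
    shift_pow_len_smul, smul_zero, map_zero]

lemma len_eq_of_equiv (e : SegMod k s ≃ₗ[OpAlg k V] SegMod k s') : s.len = s'.len :=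
  le_antisymm (len_le_of_equiv e.symm) (len_le_of_equiv e)

lemma start_eq_of_equiv (e : SegMod k s ≃ₗ[OpAlg k V] SegMod k s') : s.start = s'.start := by
  by_contra h
  have hl := len_eq_of_equiv e
  have h1 : e (bot s) = 0 := by
    rw [← shift_pow_smul_top_eq_bot, ← idem_smul_top, map_smul, map_smul]
    funext t
    rw [shift_pow_smul_apply, idem_smul_apply]
    split_ifs with h1 h2
    · rfl
    · have : t.val - (s.len - 1) = 0 := by omega
      simp only [this, Nat.cast_zero, add_zero] at h2
      exact absurd h2.symm h
    · rfl
  exact bot_ne_zero (e.map_eq_zero_iff.1 h1)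

lemma hom_eq_zero_of_start_ne (h : s.start ≠ s'.start) (h1 : s'.len = 1)
    (f : SegMod k s →ₗ[OpAlg k V] SegMod k s') : f = 0 := by
  refine hom_ext ?_
  rw [LinearMap.zero_apply, ← idem_smul_top, map_smul]
  funext t
  rw [idem_smul_apply]
  split_ifs with h2
  · have : t.val = 0 := by omega
    rw [this, Nat.cast_zero, add_zero] at h2
    exact absurd h2.symm h
  · rfl

lemma projective (h : shift k V ^ s.len * idem k s.start = 0) :
    Module.Projective (OpAlg k V) (SegMod k s) := by
  refine Module.Projective.of_lifting_property'' fun f hf => ?_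
  obtain ⟨m, hm⟩ := hf (top s)
  refine ⟨ofTop s m (by rw [← mul_smul, h, zero_smul]), hom_ext ?_⟩
  rw [LinearMap.comp_apply, ofTop_top, map_smul, hm, idem_smul_top]
  rfl

lemma injective (h : idem k (s.start + (s.len - 1 : ℕ)) * shift k V ^ s.len = 0) :
    Module.Injective (OpAlg k V) (SegMod k s) where
  out X Y _ _ _ _ f hf g := by
    let : Module k X := Module.compHom X (algebraMap k (OpAlg k V))
    let : Module k Y := Module.compHom Y (algebraMap k (OpAlg k V))
    have : IsScalarTower k (OpAlg k V) X := ⟨fun c r x => by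
      rw [Algebra.smul_def, mul_smul]; rfl⟩
    have : IsScalarTower k (OpAlg k V) Y := ⟨fun c r x => by
      rw [Algebra.smul_def, mul_smul]; rfl⟩
    obtain ⟨ρ, hρ⟩ := (f.restrictScalars k).exists_leftInverse_of_injective
      (LinearMap.ker_eq_bot.2 hf)
    let φ : SegMod k s →ₗ[k] k :=
      LinearMap.proj (R := k) (φ := fun _ : Fin s.len => k) ⟨s.len - 1, Nat.sub_lt s.pos one_pos⟩
    refine ⟨toBot s (φ.comp ((g.restrictScalars k).comp ρ)) (fun x => by
      rw [← mul_smul, h, zero_smul]), fun x => ?_⟩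
    funext t
    rw [toBot_apply, ← map_smul, ← map_smul]
    have h1 (x : X) : ρ (f x) = x := LinearMap.congr_fun hρ x
    change φ (g (ρ (f _))) = _
    rw [h1, LinearMap.map_smul g, LinearMap.map_smul g]
    change (idem k (s.start + (s.len - 1 : ℕ)) • shift k V ^ (s.len - 1 - t.val) • g x :
      SegMod k s) ⟨s.len - 1, Nat.sub_lt s.pos one_pos⟩ = _
    rw [idem_smul_apply, if_pos rfl, shift_pow_smul_apply]
    have := t.2
    rw [if_neg (by dsimp only; omega)]
    exact congrArg (g x) (Fin.ext (by dsimp only; omega))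

lemma exists_shortExact (h1 : s''.start = s.start) (h2 : s'.start = s.start + (s''.len : ℕ))
    (h3 : s'.len + s''.len = s.len) :
    ∃ (f : SegMod k s' →ₗ[OpAlg k V] SegMod k s) (g : SegMod k s →ₗ[OpAlg k V] SegMod k s''),
      Function.Injective f ∧ Function.Surjective g ∧ LinearMap.range f = LinearMap.ker g := by
  let a : SegMod k s' →ₗ[k] SegMod k s :=
    { toFun x := fun t => if h : t.val < s''.len then 0 else x ⟨t.val - s''.len, by omega⟩
      map_add' x y := by
        funext t
        change (if h : _ then 0 else x _ + y _) =
          (if h : _ then 0 else x _) + (if h : _ then 0 else y _)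
        split_ifs <;> simp
      map_smul' c x := by
        funext t
        change (if h : _ then 0 else c * x _) = c * (if h : _ then 0 else x _)
        split_ifs <;> simp }
  let b : SegMod k s →ₗ[k] SegMod k s'' :=
    { toFun x := fun t => x ⟨t.val, by omega⟩
      map_add' x y := rfl
      map_smul' c x := rfl }
  have ha (x : SegMod k s') (t : Fin s.len) :
    a x t = if h : t.val < s''.len then 0 else x ⟨t.val - s''.len, by omega⟩ := rfl
  have hb (x : SegMod k s) (t : Fin s''.len) : b x t = x ⟨t.val, by omega⟩ := rfl
  obtain ⟨A, hA⟩ : ∃ A : SegMod k s' →ₗ[OpAlg k V] SegMod k s, ∀ x t, A x t = a x t := by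
    refine ⟨homMk a (fun v x => ?_) (fun x => ?_), fun _ _ => rfl⟩
    · funext t
      rw [idem_smul_apply, ha, ha]
      by_cases h : t.val < s''.len
      · simp [h]
      · rw [dif_neg h, dif_neg h, idem_smul_apply, h2, add_assoc, ← Nat.cast_add,
          Nat.add_sub_cancel' (not_lt.1 h)]
    · funext t
      rw [shift_smul_apply, ha, ha]
      simp only [shift_smul_apply]
      have := s''.pos
      split_ifs <;> first | rfl | (exfalso; omega) | skip
      congr 1
      ext
      dsimp only
      omega
  obtain ⟨B, hB⟩ : ∃ B : SegMod k s →ₗ[OpAlg k V] SegMod k s'', ∀ x t, B x t = b x t := by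
    refine ⟨homMk b (fun v x => ?_) (fun x => ?_), fun _ _ => rfl⟩
    · funext t
      rw [idem_smul_apply, hb, hb, idem_smul_apply, h1]
    · funext t
      rw [shift_smul_apply, hb, shift_smul_apply]
      split_ifs <;> rfl
  refine ⟨A, B, fun x y hxy => ?_, fun y => ?_, ?_⟩
  · funext t
    have := congrFun hxy ⟨t.val + s''.len, by omega⟩
    rw [hA, hA, ha, ha, dif_neg (by simp), dif_neg (by simp)] at this
    simpa using this
  · let x : SegMod k s := fun t => if h : t.val < s''.len then y ⟨t.val, h⟩ else 0
    refine ⟨x, funext fun t => ?_⟩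
    rw [hB, hb]
    exact dif_pos t.2
  · refine le_antisymm ?_ fun x hx => ?_
    · rintro _ ⟨x, rfl⟩
      rw [LinearMap.mem_ker]
      funext t
      rw [hB, hb, hA, ha, dif_pos t.2]
      rfl
    · let y : SegMod k s' := fun t => x ⟨t.val + s''.len, by omega⟩
      refine ⟨y, funext fun t => ?_⟩
      rw [hA, ha]
      split_ifs with h
      · refine Eq.symm ?_
        rw [← hb x ⟨t.val, h⟩, ← hB, LinearMap.mem_ker.1 hx]
        rfl
      · change x _ = x _
        congr 1
        ext
        dsimp only
        omega

end SegMod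

end CyclicGentle

namespace CyclicGentle

variable {k : Type u} [Field k] {V : Type u} [CommRing V] [Fintype V]

section Classification

lemma exists_retract [Nontrivial V] {X : Type u} [AddCommGroup X] [Module k X]
    [Module (OpAlg k V) X] [IsScalarTower k (OpAlg k V) X] (s : Seg V) (x : X)
    (h : ∀ y : X, shift k V ^ s.len • y = 0)
    (hx : shift k V ^ (s.len - 1) • idem k s.start • x ≠ 0) :
    ∃ (f : SegMod k s →ₗ[OpAlg k V] X) (g : X →ₗ[OpAlg k V] SegMod k s),
      g.comp f = LinearMap.id := by
  obtain ⟨φ, hφ⟩ := Module.Projective.exists_dual_ne_zero k hx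
  let f := ofTop s x (h _)
  let g := toBot s φ (fun y => by rw [h, smul_zero])
  have hf : f (SegMod.bot s) = shift k V ^ (s.len - 1) • idem k s.start • x :=
    ofTop_basis s x _ _
  have hgf : (g.comp f) (SegMod.bot s) ≠ 0 := by
    intro h0
    have := congrFun h0 ⟨s.len - 1, Nat.sub_lt s.pos one_pos⟩
    rw [LinearMap.comp_apply, hf, toBot_apply, Nat.sub_self, pow_zero, one_smul,
      idem_smul_shift_pow, ← mul_smul (idem k _), idem_mul_self] at this
    exact hφ this
  have hinj := SegMod.injective_of_bot _ hgf
  have hsurj : Function.Surjective (g.comp f) :=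
    LinearMap.injective_iff_surjective (f := (g.comp f).restrictScalars k) |>.1 hinj
  let e := LinearEquiv.ofBijective (g.comp f) ⟨hinj, hsurj⟩
  exact ⟨f, e.symm.toLinearMap.comp g, LinearMap.ext fun y => e.symm_apply_apply y⟩

lemma exists_idem_smul_ne_zero {X : Type*} [AddCommGroup X] [Module (OpAlg k V) X]
    (r : OpAlg k V) {x : X} (h : r • x ≠ 0) : ∃ v : V, r • idem k v • x ≠ 0 := by
  by_contra! h0
  apply h
  rw [← one_smul (OpAlg k V) x, ← sum_idem, Finset.sum_smul, Finset.smul_sum]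
  exact Finset.sum_eq_zero fun v _ => h0 v

/-- Every indecomposable module is a segment module. -/
lemma exists_equiv_segMod [Nontrivial V] {X : ModuleCat.{u} (OpAlg k V)} (hX : IsIndec X) :
    ∃ s : Seg V, Nonempty (X ≃ₗ[OpAlg k V] SegMod k s) := by
  let : Module k X := Module.compHom X (algebraMap k (OpAlg k V))
  have : IsScalarTower k (OpAlg k V) X := ⟨fun c r x => by
    rw [Algebra.smul_def, mul_smul]; rfl⟩
  suffices ∃ (s : Seg V) (x : X), (∀ y : X, shift k V ^ s.len • y = 0) ∧
      shift k V ^ (s.len - 1) • idem k s.start • x ≠ 0 by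
    obtain ⟨s, x, h, hx⟩ := this
    obtain ⟨f, g, hfg⟩ := exists_retract s x h hx
    have : Nontrivial (ModuleCat.of (OpAlg k V) (SegMod k s)) :=
      inferInstanceAs (Nontrivial (SegMod k s))
    exact ⟨s, hX.equiv_of_retract (U := ModuleCat.of _ (SegMod k s)) f g hfg⟩
  by_cases h2 : ∃ x : X, shift k V ^ 2 • x ≠ 0
  · obtain ⟨x, hx⟩ := h2
    obtain ⟨v, hv⟩ := exists_idem_smul_ne_zero _ hx
    obtain rfl : v = 0 := by
      by_contra h0
      rw [← mul_smul, shift_sq_mul_idem k h0, zero_smul] at hv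
      exact hv rfl
    exact ⟨⟨0, 3, by simp, by simp⟩, x, fun y => by rw [shift_pow_three, zero_smul], hv⟩
  push Not at h2
  by_cases h1 : ∃ x : X, shift k V ^ 1 • x ≠ 0
  · obtain ⟨x, hx⟩ := h1
    obtain ⟨v, hv⟩ := exists_idem_smul_ne_zero _ hx
    exact ⟨⟨v, 2, by simp, by simp⟩, x, h2, hv⟩
  push Not at h1
  have := hX.1
  obtain ⟨x, hx⟩ := exists_ne (0 : X)
  obtain ⟨v, hv⟩ := exists_idem_smul_ne_zero (shift k V ^ 0) (x := x) (by simpa using hx)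
  exact ⟨⟨v, 1, by simp, by simp⟩, x, h1, hv⟩

end Classification

section Acyclic

variable (k V) in
/-- The element acting on modules as the differential of the cyclic complex obtained from the
quiver by contracting the path of length two through `1`. -/
def diff : OpAlg k V :=
  shift k V - shift k V * idem k 0 - shift k V * idem k 1 + shift k V ^ 2

lemma diff_mul_idem_one [Nontrivial V] : diff k V * idem k 1 = 0 := by
  rw [diff, add_mul, sub_mul, sub_mul, mul_assoc, mul_assoc, idem_mul_self,
    idem_mul_of_ne k zero_ne_one, shift_sq_mul_idem k one_ne_zero]
  simp

lemma shift_sq_mul_idem_zero : shift k V ^ 2 * idem k 0 = shift k V ^ 2 := by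
  classical
  conv_rhs => rw [← mul_one (shift k V ^ 2), ← sum_idem, Finset.mul_sum]
  exact (Finset.sum_eq_single 0 (fun v _ hv => shift_sq_mul_idem k hv) (by simp)).symm

lemma diff_mul_shift [Nontrivial V] : diff k V * shift k V = 0 := by
  have h (v : V) : shift k V * idem k v * shift k V = shift k V ^ 2 * idem k (v - 1) := by
    rw [sq, mul_assoc, mul_assoc, shift_comm, sub_add_cancel]
  rw [diff, add_mul, sub_mul, sub_mul, h, h, ← pow_succ, shift_pow_three, zero_sub, sub_self,
    shift_sq_mul_idem k (neg_ne_zero.2 one_ne_zero), shift_sq_mul_idem_zero, sq]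
  simp

lemma diff_mul_diff [Nontrivial V] : diff k V * diff k V = 0 := by
  conv_lhs => arg 2; rw [diff]
  simp only [mul_add, mul_sub, sq, ← mul_assoc, diff_mul_shift, zero_mul, sub_zero, add_zero]

variable (k V) in
/-- Exactness of the complex defined by `diff` on the part of the module away from the
vertex `1`. -/
def Acyclic (X : Type*) [AddCommGroup X] [Module (OpAlg k V) X] : Prop :=
  ∀ x : X, idem k (1 : V) • x = 0 → diff k V • x = 0 → ∃ y : X, diff k V • y = x

variable {X Y : Type*} [AddCommGroup X] [Module (OpAlg k V) X] [AddCommGroup Y]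
  [Module (OpAlg k V) Y]

lemma Acyclic.pi {ι : Type*} {X : ι → Type*} [∀ i, AddCommGroup (X i)]
    [∀ i, Module (OpAlg k V) (X i)] (h : ∀ i, Acyclic k V (X i)) : Acyclic k V (∀ i, X i) := by
  intro x h1 h2
  choose y hy using fun i => h i (x i) (congrFun h1 i) (congrFun h2 i)
  exact ⟨y, funext hy⟩

lemma Acyclic.prod (hX : Acyclic k V X) (hY : Acyclic k V Y) : Acyclic k V (X × Y) := by
  intro x h1 h2
  obtain ⟨y, hy⟩ := hX x.1 (congrArg Prod.fst h1) (congrArg Prod.fst h2)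
  obtain ⟨z, hz⟩ := hY x.2 (congrArg Prod.snd h1) (congrArg Prod.snd h2)
  exact ⟨(y, z), Prod.ext hy hz⟩

lemma Acyclic.retract (hY : Acyclic k V Y) (f : X →ₗ[OpAlg k V] Y) (g : Y →ₗ[OpAlg k V] X)
    (h : g.comp f = LinearMap.id) : Acyclic k V X := by
  intro x h1 h2
  obtain ⟨y, hy⟩ := hY (f x) (by rw [← map_smul, h1, map_zero]) (by rw [← map_smul, h2, map_zero])
  exact ⟨g y, by rw [← map_smul, hy]; exact LinearMap.congr_fun h x⟩

lemma Acyclic.congr (hY : Acyclic k V Y) (e : X ≃ₗ[OpAlg k V] Y) : Acyclic k V X :=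
  hY.retract e.toLinearMap e.symm.toLinearMap (LinearMap.ext e.symm_apply_apply)

lemma Acyclic.of_memAdd {T X : ModuleCat.{u} (OpAlg k V)} (hT : Acyclic k V T)
    (h : MemAdd T X) : Acyclic k V X := by
  obtain ⟨n, f, g, hfg⟩ := h
  exact (Acyclic.pi fun _ => hT).retract f g hfg

lemma Acyclic.of_quotient [Nontrivial V] (hY : Acyclic k V Y) (f : X →ₗ[OpAlg k V] Y)
    (hf : Function.Injective f) (hQ : Acyclic k V (Y ⧸ LinearMap.range f)) : Acyclic k V X := by
  intro x h1 h2
  obtain ⟨y, hy⟩ := hY (f x) (by rw [← map_smul, h1, map_zero]) (by rw [← map_smul, h2, map_zero])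
  obtain ⟨q, hq⟩ := hQ ((LinearMap.range f).mkQ (y - idem k 1 • y))
    (by rw [← map_smul, smul_sub, ← mul_smul, idem_mul_self, sub_self, map_zero])
    (by
      rw [← map_smul, smul_sub, ← mul_smul, diff_mul_idem_one, zero_smul, sub_zero, hy]
      exact (Submodule.Quotient.mk_eq_zero _).2 ⟨x, rfl⟩)
  obtain ⟨z, rfl⟩ := (LinearMap.range f).mkQ_surjective q
  rw [← map_smul] at hq
  obtain ⟨w, hw⟩ := (Submodule.Quotient.eq _).1 hq.symm
  refine ⟨w, hf ?_⟩
  rw [map_smul, hw, smul_sub, smul_sub, ← mul_smul, ← mul_smul, diff_mul_idem_one, diff_mul_diff,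
    zero_smul, zero_smul, sub_zero, sub_zero, hy]

lemma Acyclic.of_coresolvedBy [Nontrivial V] {T X : ModuleCat.{u} (OpAlg k V)} {d : ℕ}
    (hT : Acyclic k V T) (h : CoresolvedBy T X d) : Acyclic k V X := by
  induction d generalizing X with
  | zero => exact hT.of_memAdd h
  | succ d ih =>
    obtain ⟨T₀, hT₀, f, hf, hd⟩ := h
    exact (hT.of_memAdd hT₀).of_quotient f hf (ih hd)

variable {s : Seg V}

open Classical in
lemma SegMod.diff_smul_apply [Nontrivial V] (f : SegMod k s) (t : Fin s.len) :
    (diff k V • f) t =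
      (if t.val = 0 ∨ s.start + (t.val - 1 : ℕ) = 0 ∨ s.start + (t.val - 1 : ℕ) = 1 then 0
        else f ⟨t.val - 1, by omega⟩) +
      if t.val < 2 then 0 else f ⟨t.val - 2, by omega⟩ := by
  have h : (diff k V • f) t = (shift k V • f) t - (shift k V • idem k (0 : V) • f) t -
      (shift k V • idem k (1 : V) • f) t + (shift k V ^ 2 • f) t := by
    rw [diff, add_smul, sub_smul, sub_smul, mul_smul, mul_smul]
    rfl
  rw [h, shift_smul_apply, shift_smul_apply, shift_smul_apply, shift_pow_smul_apply,
    idem_smul_apply, idem_smul_apply]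
  congr 1
  by_cases h0 : t.val = 0
  · simp [h0]
  by_cases h1 : s.start + ((t.val - 1 : ℕ) : V) = 0
  · simp [h0, h1]
  · by_cases h2 : s.start + ((t.val - 1 : ℕ) : V) = 1 <;> simp [h0, h1, h2]

/-- The simple module at `v`, as a segment. -/
def segOne (v : V) : Seg V := ⟨v, 1, one_pos, by simp⟩

/-- The segment of length two starting at `v`. -/
def segTwo (v : V) : Seg V := ⟨v, 2, two_pos, by simp⟩

variable (V) in
/-- The segment of length three. -/
def segThree : Seg V := ⟨0, 3, three_pos, by simp⟩

lemma Seg.cases (s : Seg V) :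
    (∃ v, s = segOne v) ∨ (∃ v, s = segTwo v) ∨ s = segThree V := by
  obtain ⟨v, l, hl, h⟩ := s
  rcases h with h | ⟨h, rfl⟩
  · interval_cases l
    · exact Or.inl ⟨v, rfl⟩
    · exact Or.inr (Or.inl ⟨v, rfl⟩)
  · interval_cases l
    · exact Or.inl ⟨0, rfl⟩
    · exact Or.inr (Or.inl ⟨0, rfl⟩)
    · exact Or.inr (Or.inr rfl)


lemma acyclic_segTwo [Nontrivial V] {v : V} (h0 : v ≠ 0) (h1 : v ≠ 1) :
    Acyclic k V (SegMod k (segTwo v)) := by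
  intro x _ hx
  have hx0 : x (⟨0, two_pos⟩ : Fin 2) = 0 := by
    have := (SegMod.diff_smul_apply x (⟨1, one_lt_two⟩ : Fin 2)).symm.trans (congrFun hx _)
    simp [segTwo, h0, h1] at this
    exact this
  let y : SegMod k (segTwo v) := (![x (1 : Fin 2), 0] : Fin 2 → k)
  refine ⟨y, funext fun t => ?_⟩
  rw [SegMod.diff_smul_apply]
  revert t
  change ∀ t : Fin 2, _
  rw [Fin.forall_fin_two]
  constructor
  · simpa [segTwo] using hx0.symm
  · simp [segTwo, h0, h1, y]

lemma acyclic_segThree [Nontrivial V] : Acyclic k V (SegMod k (segThree V)) := by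
  intro x he hx
  have hx0 : x (⟨0, three_pos⟩ : Fin 3) = 0 := by
    have := (SegMod.diff_smul_apply x (⟨2, by decide⟩ : Fin 3)).symm.trans (congrFun hx _)
    simp [segThree] at this
    exact this
  have hx1 : x (⟨1, by decide⟩ : Fin 3) = 0 := by
    have := (SegMod.idem_smul_apply 1 x (⟨1, by decide⟩ : Fin 3)).symm.trans (congrFun he _)
    simp [segThree] at this
    exact this
  let y : SegMod k (segThree V) := (![x (2 : Fin 3), 0, 0] : Fin 3 → k)
  refine ⟨y, funext fun t => ?_⟩
  rw [SegMod.diff_smul_apply]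
  revert t
  change ∀ t : Fin 3, _
  rw [Fin.forall_fin_succ, Fin.forall_fin_two]
  refine ⟨?_, ?_, ?_⟩
  · simpa [segThree] using hx0.symm
  · simpa [segThree] using hx1.symm
  · simp [segThree, y]

lemma acyclic_segOne_one : Acyclic k V (SegMod k (segOne (1 : V))) := by
  intro x he _
  refine ⟨0, ?_⟩
  rw [smul_zero]
  funext t
  have := congrFun he t
  rw [SegMod.idem_smul_apply, if_pos] at this
  · exact this.symm
  · have : t.val = 0 := Nat.lt_one_iff.1 t.2
    simp [this, segOne]

lemma not_acyclic_segMod (t : Fin s.len) (ht : s.start + (t : ℕ) ≠ 1)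
    (h : ∀ x : SegMod k s, diff k V • x = 0) : ¬ Acyclic k V (SegMod k s) := by
  intro ha
  obtain ⟨y, hy⟩ := ha (SegMod.basis s t) (SegMod.idem_smul_basis_of_ne t ht) (h _)
  have := congrFun (hy.symm.trans (h y)) t
  rw [SegMod.basis_apply, if_pos rfl] at this
  exact one_ne_zero this

lemma not_acyclic_segOne [Nontrivial V] {v : V} (h : v ≠ 1) :
    ¬ Acyclic k V (SegMod k (segOne v)) := by
  refine not_acyclic_segMod (⟨0, one_pos⟩ : Fin 1) (by simpa [segOne] using h) fun x => ?_
  funext t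
  have : t.val = 0 := Nat.lt_one_iff.1 t.2
  rw [SegMod.diff_smul_apply]
  rw [if_pos (Or.inl this), if_pos (by omega)]
  exact add_zero 0

lemma not_acyclic_segTwo [Nontrivial V] {v : V} (h : v = 0 ∨ v = 1) :
    ¬ Acyclic k V (SegMod k (segTwo v)) := by
  have h1 : ∃ t : Fin 2, v + (t : ℕ) ≠ 1 := by
    rcases h with rfl | rfl
    · exact ⟨0, by simp⟩
    · exact ⟨1, by simp⟩
  obtain ⟨t, ht⟩ := h1
  refine not_acyclic_segMod (s := segTwo v) t ht fun x => ?_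
  funext t
  rw [SegMod.diff_smul_apply]
  revert t
  change ∀ t : Fin 2, _
  rw [Fin.forall_fin_two]
  constructor
  · simp [segTwo]
    rfl
  · simp [segTwo, h]
    rfl

end Acyclic

end CyclicGentle

namespace CyclicGentle

variable {k : Type u} [Field k] {V : Type u} [CommRing V] [Fintype V]

section Projectives

open Classical in
/-- The support of the indecomposable projective module at `v`. -/
noncomputable def projSeg (v : V) : Seg V := if v = 0 then segThree V else segTwo v

lemma projSeg_zero : projSeg (0 : V) = segThree V := if_pos rfl

lemma projSeg_of_ne {v : V} (h : v ≠ 0) : projSeg v = segTwo v := if_neg h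

lemma projSeg_start (v : V) : (projSeg v).start = v := by
  by_cases h : v = 0
  · rw [h, projSeg_zero, segThree]
  · rw [projSeg_of_ne h, segTwo]

lemma shift_pow_mul_idem_projSeg [Nontrivial V] (v : V) :
    shift k V ^ (projSeg v).len * idem k v = 0 := by
  by_cases h : v = 0
  · rw [h, projSeg_zero]
    change shift k V ^ 3 * _ = 0
    rw [shift_pow_three, zero_mul]
  · rw [projSeg_of_ne h]
    exact shift_sq_mul_idem k h

instance projective_projSeg [Nontrivial V] (v : V) :
    Module.Projective (OpAlg k V) (SegMod k (projSeg v)) :=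
  SegMod.projective (by rw [projSeg_start, shift_pow_mul_idem_projSeg])

lemma injective_segTwo {v : V} (h : v ≠ 1) :
    Module.Injective (OpAlg k V) (SegMod k (segTwo v)) :=
  SegMod.injective (idem_mul_shift_sq k fun h1 => h (by
    have : v + ((1 : ℕ) : V) = 2 := h1
    rwa [Nat.cast_one, ← one_add_one_eq_two, add_left_inj] at this))

lemma injective_projSeg [Nontrivial V] {v : V} (h : v ≠ 1) :
    Module.Injective (OpAlg k V) (SegMod k (projSeg v)) := by
  by_cases h0 : v = 0
  · rw [h0, projSeg_zero]
    refine SegMod.injective ?_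
    change _ * shift k V ^ 3 = 0
    rw [shift_pow_three, mul_zero]
  · rw [projSeg_of_ne h0]
    exact injective_segTwo h

lemma acyclic_projSeg [Nontrivial V] {v : V} (h : v ≠ 1) :
    Acyclic k V (SegMod k (projSeg v)) := by
  by_cases h0 : v = 0
  · rw [h0, projSeg_zero]
    exact acyclic_segThree
  · rw [projSeg_of_ne h0]
    exact acyclic_segTwo h0 h

variable (k V) in
/-- The direct sum of all indecomposable projective modules except the one at `1`. -/
noncomputable def almostTilting : ModuleCat.{u} (OpAlg k V) :=
  ModuleCat.of _ (∀ v : {v : V // v ≠ 1}, SegMod k (projSeg v.1))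

instance : Module.Finite (OpAlg k V) (almostTilting k V) :=
  inferInstanceAs (Module.Finite _ (∀ v : {v : V // v ≠ 1}, SegMod k (projSeg v.1)))

instance [Nontrivial V] : Module.Projective (OpAlg k V) (almostTilting k V) := by
  classical
  exact Module.Projective.of_equiv (DFinsupp.linearEquivFunOnFintype (R := OpAlg k V)
    (M := fun v : {v : V // v ≠ 1} => SegMod k (projSeg v.1)))

instance [Nontrivial V] : Module.Injective (OpAlg k V) (almostTilting k V) := by
  have (v : {v : V // v ≠ 1}) : Module.Injective (OpAlg k V) (SegMod k (projSeg v.1)) :=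
    injective_projSeg v.2
  exact inferInstanceAs
    (Module.Injective _ (∀ v : {v : V // v ≠ 1}, SegMod k (projSeg v.1)))

lemma acyclic_almostTilting [Nontrivial V] : Acyclic k V (almostTilting k V) :=
  Acyclic.pi fun v : {v : V // v ≠ 1} => acyclic_projSeg v.2

lemma memAdd_almostTilting {v : V} (h : v ≠ 1) :
    MemAdd (almostTilting k V) (ModuleCat.of (OpAlg k V) (SegMod k (projSeg v))) := by
  classical
  refine MemAdd.of_retract (X := ModuleCat.of (OpAlg k V) (SegMod k (projSeg v)))
    (T := almostTilting k V)
    (LinearMap.single (OpAlg k V) (fun v : {v : V // v ≠ 1} => SegMod k (projSeg v.1)) ⟨v, h⟩)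
    (LinearMap.proj (φ := fun v : {v : V // v ≠ 1} => SegMod k (projSeg v.1)) ⟨v, h⟩) ?_
  exact LinearMap.proj_comp_single_same _ _ _

lemma hasRank_almostTilting [Nontrivial V] {m : ℕ} (e : Fin m ≃ {v : V // v ≠ 1}) :
    HasRank (almostTilting k V) m := by
  refine ⟨fun i => ModuleCat.of _ (SegMod k (projSeg (e i).1)), fun i => SegMod.isIndec,
    fun i j hij => ⟨fun f => hij ?_⟩,
    ⟨(LinearEquiv.piCongrLeft (OpAlg k V)
      (fun v : {v : V // v ≠ 1} => SegMod k (projSeg v.1)) e).symm⟩⟩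
  have := SegMod.start_eq_of_equiv f
  rw [projSeg_start, projSeg_start] at this
  exact e.injective (Subtype.ext this)

lemma isPreTilting_almostTilting [Nontrivial V] : IsPreTilting (almostTilting k V) :=
  ⟨⟨0, inferInstanceAs (Module.Projective (OpAlg k V) (almostTilting k V))⟩, fun _ hi =>
    extGroup_subsingleton_of_projective _ _ inferInstance hi⟩

/-- The projective cover of the simple module at `v` as a left ideal. -/
noncomputable def ofProj [Nontrivial V] (v : V) : SegMod k (projSeg v) →ₗ[OpAlg k V] OpAlg k V :=
  ofTop (projSeg v) (1 : OpAlg k V)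
    (by rw [projSeg_start, smul_eq_mul, smul_eq_mul, mul_one, shift_pow_mul_idem_projSeg])

lemma ofProj_top [Nontrivial V] (v : V) : ofProj v (SegMod.top _) = idem k v := by
  rw [ofProj, ofTop_top, projSeg_start, smul_eq_mul, mul_one]

lemma idem_smul_top_projSeg (v : V) :
    idem k v • (SegMod.top (projSeg v) : SegMod k _) = SegMod.top _ := by
  have := SegMod.idem_smul_top (k := k) (s := projSeg v)
  rwa [projSeg_start] at this

lemma idem_smul_top_projSeg_of_ne {v w : V} (h : w ≠ v) :
    idem k v • (SegMod.top (projSeg w) : SegMod k _) = 0 := by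
  rw [← idem_smul_top_projSeg, ← mul_smul, idem_mul_of_ne k h.symm, zero_smul]

variable (k V) in
/-- The regular module is the direct sum of the indecomposable projective modules. -/
lemma nonempty_regular_equiv [Nontrivial V] :
    Nonempty (OpAlg k V ≃ₗ[OpAlg k V] SegMod k (projSeg (1 : V)) × almostTilting k V) := by
  classical
  let M : {v : V // v ≠ 1} → Type u := fun v => SegMod k (projSeg v.1)
  let F : OpAlg k V →ₗ[OpAlg k V] SegMod k (projSeg (1 : V)) × (∀ v, M v) :=
    LinearMap.toSpanSingleton _ _ (SegMod.top _, fun v => SegMod.top _)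
  let G : SegMod k (projSeg (1 : V)) × (∀ v, M v) →ₗ[OpAlg k V] OpAlg k V :=
    (ofProj 1).coprod (∑ v : {v : V // v ≠ 1}, (ofProj v.1).comp (LinearMap.proj v))
  have hG1 : G (SegMod.top _, 0) = idem k 1 := by
    simp [G, ofProj_top]
  have hG2 (v : {v : V // v ≠ 1}) : G (0, Pi.single v (SegMod.top _)) = idem k v.1 := by
    simp only [G, LinearMap.coprod_apply, map_zero, zero_add, LinearMap.sum_apply,
      LinearMap.comp_apply, LinearMap.proj_apply]
    rw [Finset.sum_eq_single v (fun w _ hw => by rw [Pi.single_eq_of_ne hw, map_zero])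
      (by simp), Pi.single_eq_same, ofProj_top]
  have hFG : F.comp G = LinearMap.id := by
    refine LinearMap.prod_ext (SegMod.hom_ext ?_)
      (LinearMap.pi_ext' fun v => SegMod.hom_ext ?_)
    · change F (G (SegMod.top _, 0)) = (SegMod.top _, 0)
      rw [hG1]
      exact Prod.ext (idem_smul_top_projSeg _)
        (funext fun w => idem_smul_top_projSeg_of_ne w.2)
    · change F (G (0, Pi.single v (SegMod.top _))) = (0, Pi.single v (SegMod.top _))
      rw [hG2]
      refine Prod.ext (idem_smul_top_projSeg_of_ne v.2.symm) (funext fun w => ?_)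
      change idem k v.1 • (SegMod.top (projSeg w.1) : SegMod k _) = _
      by_cases h : w = v
      · subst h
        rw [idem_smul_top_projSeg]
        exact (Pi.single_eq_same (M := M) _ _).symm
      · rw [idem_smul_top_projSeg_of_ne (Subtype.coe_ne_coe.2 h)]
        exact (Pi.single_eq_of_ne (M := M) h _).symm
  have hGF : G.comp F = LinearMap.id := by
    refine LinearMap.ext_ring ?_
    change G ((1 : OpAlg k V) • _) = 1
    rw [one_smul]
    simp only [G, LinearMap.coprod_apply, LinearMap.sum_apply, LinearMap.comp_apply,
      LinearMap.proj_apply, ofProj_top]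
    rw [← sum_idem]
    exact (Fintype.sum_eq_add_sum_subtype_ne (idem k) 1).symm
  exact ⟨LinearEquiv.ofLinearMap F G hFG hGF⟩

instance finiteDimensional_gentleAlg [Nontrivial V] :
    FiniteDimensional k (GentleAlg k (cyclicQuiver V)) := by
  obtain ⟨e⟩ := nonempty_regular_equiv k V
  let e' : (SegMod k (projSeg (1 : V)) × ∀ v : {v : V // v ≠ 1}, SegMod k (projSeg v.1))
      ≃ₗ[OpAlg k V] OpAlg k V := e.symm
  have : Module.Finite k (OpAlg k V) := Module.Finite.equiv (e'.restrictScalars k)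
  exact Module.Finite.equiv (MulOpposite.opLinearEquiv k).symm

end Projectives

end CyclicGentle

namespace CyclicGentle

variable {k : Type u} [Field k] {V : Type u} [CommRing V] [Fintype V] [Nontrivial V]

section Complements

variable {n : ℕ}

variable (V n) in
/-- The supports of the complements. -/
def chainSeg (l : ℕ) : Seg V :=
  if l = 0 then segTwo 1 else if l < n then segOne (1 - (l : V)) else segTwo 0

lemma chainSeg_zero : chainSeg V n 0 = segTwo 1 := if_pos rfl

lemma chainSeg_of_lt {l : ℕ} (h0 : 0 < l) (h : l < n) :
    chainSeg V n l = segOne (1 - (l : V)) := by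
  rw [chainSeg, if_neg h0.ne', if_pos h]

lemma chainSeg_self (h : 0 < n) : chainSeg V n n = segTwo 0 := by
  rw [chainSeg, if_neg h.ne', if_neg (lt_irrefl n)]

lemma cast_ne_zero [CharP V n] {l : ℕ} (h0 : 0 < l) (h : l < n) : (l : V) ≠ 0 := by
  rw [Ne, CharP.cast_eq_zero_iff V n]
  exact Nat.not_dvd_of_pos_of_lt h0 h

variable (k) in
lemma exists_shortExact_chainSeg [CharP V n] (hn : 2 ≤ n) {l : ℕ} (h : l < n) :
    ∃ v : V, v ≠ 1 ∧ ∃ (f : SegMod k (chainSeg V n l) →ₗ[OpAlg k V] SegMod k (projSeg v))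
      (g : SegMod k (projSeg v) →ₗ[OpAlg k V] SegMod k (chainSeg V n (l + 1))),
      Function.Injective f ∧ Function.Surjective g ∧ LinearMap.range f = LinearMap.ker g := by
  have hn0 : (n : V) = 0 := CharP.cast_eq_zero V n
  rcases Nat.eq_zero_or_pos l with rfl | h0
  · refine ⟨0, zero_ne_one, ?_⟩
    rw [chainSeg_zero, chainSeg_of_lt (by omega) (by omega), projSeg_zero]
    exact SegMod.exists_shortExact (by simp [segOne, segThree])
      (by simp [segTwo, segOne, segThree]) rfl
  · rw [chainSeg_of_lt h0 h]
    rcases (Nat.succ_le_of_lt h).eq_or_lt with h1 | h1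
    · refine ⟨0, zero_ne_one, ?_⟩
      have hl : (l : V) + 1 = 0 := by rw [← hn0, ← h1]; push_cast; rfl
      rw [show l + 1 = n from h1, chainSeg_self (by omega), projSeg_zero]
      refine SegMod.exists_shortExact rfl ?_ rfl
      simp only [segOne, segTwo, segThree]
      push_cast
      linear_combination -hl
    · have hl : (l : V) ≠ 0 := cast_ne_zero h0 h
      have hl1 : ((l + 1 : ℕ) : V) ≠ 0 := cast_ne_zero (Nat.succ_pos l) h1
      refine ⟨-l, fun h => hl1 (by push_cast; linear_combination -h), ?_⟩
      rw [chainSeg_of_lt (Nat.succ_pos l) h1, projSeg_of_ne (neg_ne_zero.2 hl)]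
      refine SegMod.exists_shortExact ?_ ?_ rfl
      · simp [segOne, segTwo]
      · simp only [segOne, segTwo]
        push_cast
        ring

variable (k V n) in
/-- The complements of `almostTilting k V`. -/
noncomputable abbrev chainMod (l : ℕ) : ModuleCat.{u} (OpAlg k V) :=
  ModuleCat.of _ (SegMod k (chainSeg V n l))

lemma projective_chainMod_zero : Module.Projective (OpAlg k V) (chainMod k V n 0) := by
  change Module.Projective _ (SegMod k (chainSeg V n 0))
  rw [chainSeg_zero, ← projSeg_of_ne one_ne_zero]
  infer_instance

lemma injective_chainMod_self (h : 0 < n) : Module.Injective (OpAlg k V) (chainMod k V n n) := by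
  change Module.Injective _ (SegMod k (chainSeg V n n))
  rw [chainSeg_self h]
  exact injective_segTwo zero_ne_one

lemma hom_chainMod_eq_zero [CharP V n] {l j : ℕ} (hlj : l < j) (hj : j < n)
    (f : chainMod k V n l →ₗ[OpAlg k V] chainMod k V n j) : f = 0 := by
  refine SegMod.hom_eq_zero_of_start_ne ?_ ?_ f
  · rw [chainSeg_of_lt (Nat.zero_lt_of_lt hlj) hj]
    rcases Nat.eq_zero_or_pos l with rfl | h0
    · rw [chainSeg_zero]
      intro h
      have h' : (1 : V) = 1 - j := h
      exact cast_ne_zero hlj hj (by linear_combination h')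
    · rw [chainSeg_of_lt h0 (hlj.trans hj)]
      intro h
      have h' : (1 : V) - l = 1 - j := h
      exact hlj.ne (CharP.natCast_injOn_Iio V n (hlj.trans hj) hj (by linear_combination -h'))
  · rw [chainSeg_of_lt (Nat.zero_lt_of_lt hlj) hj]
    rfl

lemma projDimLE_chainMod [CharP V n] (hn : 2 ≤ n) {l : ℕ} (h : l ≤ n) :
    ProjDimLE (chainMod k V n l) l := by
  induction l with
  | zero => exact projective_chainMod_zero
  | succ l ih =>
    obtain ⟨v, -, f, g, hf, hg, hfg⟩ := exists_shortExact_chainSeg k (V := V) hn h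
    exact ProjDimLE.cons (X := chainMod k V n l) (Y := ModuleCat.of _ (SegMod k (projSeg v)))
      (Z := chainMod k V n (l + 1)) (ih (by omega)) (projective_projSeg v) f g hf hg hfg

lemma extGroup_chainMod_subsingleton [CharP V n] (hn : 2 ≤ n) {l j : ℕ} (hlj : l ≤ j)
    (hj : j ≤ n) {i : ℕ} (hi : 0 < i) :
    Subsingleton (ExtGroup (chainMod k V n l) (chainMod k V n j) i) := by
  rcases hj.eq_or_lt with rfl | hj
  · exact extGroup_subsingleton_of_injective _ _ (injective_chainMod_self (by omega)) hi
  induction l generalizing i with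
  | zero => exact extGroup_subsingleton_of_projective _ _ projective_chainMod_zero hi
  | succ l ih =>
    obtain ⟨v, -, f, g, hf, hg, hfg⟩ :=
      exists_shortExact_chainSeg k (V := V) hn (l := l) (by omega)
    exact extGroup_subsingleton_of_shortExact (X₁ := chainMod k V n l)
      (X₂ := ModuleCat.of _ (SegMod k (projSeg v))) (X₃ := chainMod k V n (l + 1)) _
      (projective_projSeg v) f g hf hg hfg (hom_chainMod_eq_zero hlj hj)
      (fun i hi => ih (by omega) hi) hi

lemma coresolvedBy_chainMod [CharP V n] (hn : 2 ≤ n) {T : ModuleCat.{u} (OpAlg k V)}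
    (hT : ∀ v : V, v ≠ 1 → MemAdd T (ModuleCat.of _ (SegMod k (projSeg v)))) {l : ℕ}
    (h : MemAdd T (chainMod k V n l)) (hl : l ≤ n) {d j : ℕ} (hd : j + d = l) :
    CoresolvedBy T (chainMod k V n j) d := by
  induction d generalizing j with
  | zero =>
    obtain rfl : j = l := hd
    exact h
  | succ d ih =>
    obtain ⟨v, hv, f, g, hf, hg, hfg⟩ :=
      exists_shortExact_chainSeg k (V := V) hn (l := j) (by omega)
    exact CoresolvedBy.cons (X := chainMod k V n j) (Y := ModuleCat.of _ (SegMod k (projSeg v)))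
      (Z := chainMod k V n (j + 1)) (ih (by omega)) (hT v hv) f g hf hg hfg

lemma isTilting_dSum_chainMod [CharP V n] (hn : 2 ≤ n) {l : ℕ} (hl : l ≤ n) :
    IsTilting (dSum (almostTilting k V) (chainMod k V n l)) := by
  refine ⟨⟨l, (projDimLE_chainMod hn hl).prod inferInstance⟩, fun i hi =>
    extGroup_dSum_subsingleton hi inferInstance inferInstance
      (extGroup_chainMod_subsingleton hn le_rfl hl hi), l, ?_⟩
  have hM : MemAdd (dSum (almostTilting k V) (chainMod k V n l)) (almostTilting k V) :=
    MemAdd.of_retract (T := dSum (almostTilting k V) (chainMod k V n l))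
      (LinearMap.inl (OpAlg k V) (almostTilting k V) (chainMod k V n l))
      (LinearMap.fst (OpAlg k V) (almostTilting k V) (chainMod k V n l)) rfl
  have hN : MemAdd (dSum (almostTilting k V) (chainMod k V n l)) (chainMod k V n l) :=
    MemAdd.of_retract (T := dSum (almostTilting k V) (chainMod k V n l))
      (LinearMap.inr (OpAlg k V) (almostTilting k V) (chainMod k V n l))
      (LinearMap.snd (OpAlg k V) (almostTilting k V) (chainMod k V n l)) rfl
  have h0 := (coresolvedBy_chainMod hn (fun v hv => by
    classical
    exact hM.retract (X := ModuleCat.of _ (SegMod k (projSeg v)))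
      (LinearMap.single (OpAlg k V) (fun v : {v : V // v ≠ 1} => SegMod k (projSeg v.1)) ⟨v, hv⟩)
      (LinearMap.proj (φ := fun v : {v : V // v ≠ 1} => SegMod k (projSeg v.1)) ⟨v, hv⟩)
      (LinearMap.proj_comp_single_same _ _ _)) hN hl (zero_add l)).prod hM
  obtain ⟨e⟩ := nonempty_regular_equiv k V
  rw [projSeg_of_ne one_ne_zero, ← chainSeg_zero (n := n)] at e
  exact h0.congr (X := ModuleCat.of _ (OpAlg k V)) e

lemma not_memAdd_chainMod [CharP V n] (hn : 2 ≤ n) {l : ℕ} (hl : l ≤ n) :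
    ¬ MemAdd (almostTilting k V) (chainMod k V n l) := by
  intro h
  have ha : Acyclic k V (SegMod k (chainSeg V n l)) := acyclic_almostTilting.of_memAdd h
  rcases Nat.eq_zero_or_pos l with rfl | h0
  · rw [chainSeg_zero] at ha
    exact not_acyclic_segTwo (Or.inr rfl) ha
  rcases hl.eq_or_lt with rfl | hl
  · rw [chainSeg_self h0] at ha
    exact not_acyclic_segTwo (Or.inl rfl) ha
  · rw [chainSeg_of_lt h0 hl] at ha
    exact not_acyclic_segOne (fun h => cast_ne_zero h0 hl (sub_eq_self.1 h)) ha

lemma isComplement_chainMod [CharP V n] (hn : 2 ≤ n) {l : ℕ} (hl : l ≤ n) :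
    IsComplement (almostTilting k V) (chainMod k V n l) :=
  ⟨inferInstanceAs (Module.Finite (OpAlg k V) (SegMod k _)), SegMod.isIndec,
    not_memAdd_chainMod hn hl, isTilting_dSum_chainMod hn hl⟩

lemma isEmpty_chainMod_equiv [CharP V n] {l j : ℕ} (hlj : l < j) (hj : j ≤ n) :
    IsEmpty (chainMod k V n l ≃ₗ[OpAlg k V] chainMod k V n j) := by
  refine ⟨fun e => ?_⟩
  rcases hj.eq_or_lt with rfl | hj
  · have h1 := SegMod.start_eq_of_equiv e
    have h2 := SegMod.len_eq_of_equiv e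
    rw [chainSeg_self (Nat.zero_lt_of_lt hlj)] at h1 h2
    rcases Nat.eq_zero_or_pos l with rfl | h0
    · rw [chainSeg_zero] at h1
      exact one_ne_zero h1
    · rw [chainSeg_of_lt h0 hlj] at h2
      have h2' : 1 = 2 := h2
      omega
  · refine SegMod.bot_ne_zero (k := k) (s := chainSeg V n l) ((e.map_eq_zero_iff).1 ?_)
    rw [← e.coe_coe, hom_chainMod_eq_zero hlj hj e.toLinearMap, LinearMap.zero_apply]

lemma exists_equiv_chainMod [CharP V n] (hn : 2 ≤ n) (hV : ∀ v : V, ∃ l < n, (l : V) = v)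
    {X : ModuleCat.{u} (OpAlg k V)} (hX : IsComplement (almostTilting k V) X) :
    ∃ l ≤ n, Nonempty (X ≃ₗ[OpAlg k V] chainMod k V n l) := by
  obtain ⟨-, hi, hM, -, -, d, hd⟩ := hX
  obtain ⟨s, ⟨e⟩⟩ := exists_equiv_segMod hi
  have hproj {v : V} (hv : v ≠ 1) (hs : s = projSeg v) : False := by
    subst hs
    exact hM ((memAdd_almostTilting hv).congr e)
  rcases Seg.cases s with ⟨v, rfl⟩ | ⟨v, rfl⟩ | rfl
  · by_cases hv : v = 1
    · exfalso
      subst hv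
      have hT : Acyclic k V (dSum (almostTilting k V) X) :=
        acyclic_almostTilting.prod (acyclic_segOne_one.congr e)
      obtain ⟨e'⟩ := nonempty_regular_equiv k V
      rw [projSeg_of_ne one_ne_zero] at e'
      have hR : Acyclic k V (OpAlg k V) := hT.of_coresolvedBy hd
      exact not_acyclic_segTwo (Or.inr rfl) ((hR.congr e'.symm).retract
        (LinearMap.inl (OpAlg k V) _ _) (LinearMap.fst (OpAlg k V) _ _) rfl)
    · obtain ⟨l, hl, h⟩ := hV (1 - v)
      have h0 : 0 < l := Nat.pos_of_ne_zero fun h0 => hv (by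
        subst h0
        rw [Nat.cast_zero] at h
        linear_combination h)
      refine ⟨l, hl.le, ?_⟩
      change Nonempty (X ≃ₗ[OpAlg k V] SegMod k _)
      rw [chainSeg_of_lt h0 hl, h, sub_sub_cancel]
      exact ⟨e⟩
  · by_cases h0 : v = 0
    · subst h0
      refine ⟨n, le_rfl, ?_⟩
      change Nonempty (X ≃ₗ[OpAlg k V] SegMod k _)
      rw [chainSeg_self (by omega)]
      exact ⟨e⟩
    · by_cases h1 : v = 1
      · subst h1
        refine ⟨0, Nat.zero_le n, ?_⟩
        change Nonempty (X ≃ₗ[OpAlg k V] SegMod k _)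
        rw [chainSeg_zero]
        exact ⟨e⟩
      · exact (hproj h1 (projSeg_of_ne h0).symm).elim
  · exact (hproj zero_ne_one projSeg_zero.symm).elim

end Complements

end CyclicGentle

/-- For every `n ≥ 2` there exist a gentle algebra of rank `n` and an
almost-tilting module over it having exactly `n + 1` isomorphism classes of complements. -/
theorem exists_almost_tilting_with_n_plus_one_complements
    (n : ℕ) (hn : 2 ≤ n)
    (k : Type u) [Field k] [IsAlgClosed k] :
    ∃ Q : GentleQuiverData.{u},
      Fintype.card Q.V = n ∧ FiniteDimensional k (GentleAlg k Q) ∧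
      ∃ M : ModuleCat.{u} (GentleAlg k Q)ᵐᵒᵖ,
        Module.Finite (GentleAlg k Q)ᵐᵒᵖ M ∧ IsPreTilting M ∧ HasRank M (n - 1) ∧
        ∃ N : Fin (n + 1) → ModuleCat.{u} (GentleAlg k Q)ᵐᵒᵖ,
          (∀ i j, i ≠ j → IsEmpty (N i ≃ₗ[(GentleAlg k Q)ᵐᵒᵖ] N j)) ∧
          (∀ i, IsComplement M (N i)) ∧
          (∀ X : ModuleCat.{u} (GentleAlg k Q)ᵐᵒᵖ, IsComplement M X →
            ∃ i, Nonempty (X ≃ₗ[(GentleAlg k Q)ᵐᵒᵖ] N i)) := by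
  classical
  have : NeZero n := ⟨by omega⟩
  have : Fact (1 < n) := ⟨hn⟩
  let V := ULift.{u} (ZMod n)
  have hcard : Fintype.card V = n := (Fintype.card_ulift _).trans (ZMod.card n)
  have : CharP V n := ULift.charP (ZMod n) n
  have hV (v : V) : ∃ l < n, (l : V) = v :=
    ⟨v.down.val, ZMod.val_lt _, ULift.down_injective (ZMod.natCast_zmod_val v.down)⟩
  have hcard' : Fintype.card {v : V // v ≠ 1} = n - 1 := by
    rw [Fintype.card_subtype_compl, Fintype.card_subtype_eq, hcard]
  refine ⟨cyclicQuiver V, hcard, CyclicGentle.finiteDimensional_gentleAlg,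
    CyclicGentle.almostTilting k V, inferInstance, CyclicGentle.isPreTilting_almostTilting,
    CyclicGentle.hasRank_almostTilting (finCongr hcard' |>.symm.trans (Fintype.equivFin _).symm),
    fun i => CyclicGentle.chainMod k V n i, fun i j hij => ?_,
    fun i => CyclicGentle.isComplement_chainMod hn (by omega), fun X hX => ?_⟩
  · rcases lt_or_gt_of_ne hij with h | h
    · exact CyclicGentle.isEmpty_chainMod_equiv h (by omega)
    · exact ⟨fun e => (CyclicGentle.isEmpty_chainMod_equiv h (by omega)).false e.symm⟩
  · obtain ⟨l, hl, h⟩ := CyclicGentle.exists_equiv_chainMod hn hV hX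
    exact ⟨⟨l, by omega⟩, h⟩
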